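/- (Theorem 1.1, second identity.) As formal power series in ℤ⟦q⟧: 7·φ(q⁷)²·ψ(q⁷) = 8q²·ψ(q²)·ψ(q²¹)·φ(q³) + 8·ψ(q²)·f(q,q⁵)·f(q⁷,q¹⁴) − 4q·ψ(q¹⁴)·ψ(q)·φ(q) − ψ(q⁷)·φ(q)². -/

import Mathlib

open PowerSeries

/-- `phi k` is the theta series `φ(q^k)`, i.e. the formal power
series whose coefficient of `qⁿ` is `#{m ∈ ℤ : n = k·m²}`. -/
noncomputable def phi (k : ℕ) : PowerSeries ℤ :=
  PowerSeries.mk fun n => ({m : ℤ | (n : ℤ) = k * m ^ 2}.ncard : ℤ)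

/-- `psi k` is the theta series `ψ(q^k)`, i.e. the formal
power series whose coefficient of `qⁿ` is `#{m ∈ ℤ, m ≥ 0 : n = k·m(m+1)/2}`. -/
noncomputable def psi (k : ℕ) : PowerSeries ℤ :=
  PowerSeries.mk fun n => ({m : ℤ | 0 ≤ m ∧ (n : ℤ) = k * (m * (m + 1) / 2)}.ncard : ℤ)

/-- `fA k` is Ramanujan's `f(q,q²)` with `q` replaced by `q^k`,
i.e. the formal power series whose coefficient of `qⁿ` is `#{m ∈ ℤ : n = k·m(3m+1)/2}`. -/
noncomputable def fA (k : ℕ) : PowerSeries ℤ :=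
  PowerSeries.mk fun n => ({m : ℤ | (n : ℤ) = k * (m * (3 * m + 1) / 2)}.ncard : ℤ)

/-- `fB k` is Ramanujan's `f(q,q⁵)` with `q` replaced by `q^k`,
i.e. the formal power series whose coefficient of `qⁿ` is `#{m ∈ ℤ : n = k·m(3m+2)}`. -/
noncomputable def fB (k : ℕ) : PowerSeries ℤ :=
  PowerSeries.mk fun n => ({m : ℤ | (n : ℤ) = k * (m * (3 * m + 2))}.ncard : ℤ)


namespace T7

noncomputable def GS {ι : Type} (S : Set ι) (w : ι → ℤ) : PowerSeries ℤ :=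
  PowerSeries.mk fun n => ({i | i ∈ S ∧ w i = (n : ℤ)}.ncard : ℤ)

def Adm {ι : Type} (S : Set ι) (w : ι → ℤ) : Prop :=
  (∀ i ∈ S, 0 ≤ w i) ∧ ∀ n : ℤ, {i | i ∈ S ∧ w i ≤ n}.Finite

theorem Adm.fin {ι : Type} {S : Set ι} {w : ι → ℤ} (h : Adm S w) (n : ℤ) :
    {i | i ∈ S ∧ w i = n}.Finite :=
  (h.2 n).subset fun _ hi => ⟨hi.1, hi.2.le⟩

theorem Adm.mono {ι : Type} {S T : Set ι} {w : ι → ℤ} (h : Adm T w) (hST : S ⊆ T) : Adm S w :=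
  ⟨fun i hi => h.1 i (hST hi), fun n => (h.2 n).subset fun _ hi => ⟨hST hi.1, hi.2⟩⟩

theorem Adm.prod {ι κ : Type} {S : Set ι} {T : Set κ} {w : ι → ℤ} {v : κ → ℤ}
    (h : Adm S w) (h' : Adm T v) : Adm (S ×ˢ T) (fun p => w p.1 + v p.2) := by
  refine ⟨fun p hp => add_nonneg (h.1 _ hp.1) (h'.1 _ hp.2), fun n => ?_⟩
  refine ((h.2 n).prod (h'.2 n)).subset ?_
  rintro ⟨i, j⟩ ⟨⟨hi, hj⟩, hw⟩
  have a := h.1 i hi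
  have b := h'.1 j hj
  simp only at hw hi hj
  exact ⟨⟨hi, by simp only; omega⟩, ⟨hj, by simp only; omega⟩⟩

theorem Adm.image {ι κ : Type} {S : Set ι} {T : Set κ} {w : ι → ℤ} {v : κ → ℤ}
    (h : Adm S w) (g : κ → ι) (hg : Set.MapsTo g T S) (hi : Set.InjOn g T)
    (hw : ∀ j ∈ T, w (g j) = v j) : Adm T v := by
  refine ⟨fun j hj => by rw [← hw j hj]; exact h.1 _ (hg hj), fun n => ?_⟩
  refine Set.Finite.of_finite_image (f := g) ((h.2 n).subset ?_) (fun a ha b hb => hi ha.1 hb.1)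
  rintro _ ⟨j, hj, rfl⟩
  exact ⟨hg hj.1, by rw [hw j hj.1]; exact hj.2⟩

theorem adm1 {S : Set ℤ} {w : ℤ → ℤ} (c : ℤ) (h0 : ∀ m ∈ S, 0 ≤ w m)
    (h : ∀ m ∈ S, |m| ≤ w m + c) : Adm S w := by
  refine ⟨h0, fun n => (Set.finite_Icc (-(n + c)) (n + c)).subset ?_⟩
  rintro m ⟨hm, hw⟩
  have := abs_le.1 (h m hm)
  exact ⟨by omega, by omega⟩

theorem GS_bij {ι κ : Type} {S : Set ι} {T : Set κ} {w : ι → ℤ} {v : κ → ℤ} (f : ι → κ) (g : κ → ι)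
    (hf : ∀ i ∈ S, f i ∈ T) (hg : ∀ j ∈ T, g j ∈ S) (hgf : ∀ i ∈ S, g (f i) = i)
    (hfg : ∀ j ∈ T, f (g j) = j) (hw : ∀ i ∈ S, v (f i) = w i) : GS S w = GS T v := by
  ext n
  simp only [GS, PowerSeries.coeff_mk]
  congr 1
  refine Set.ncard_congr (fun i _ => f i) ?_ ?_ ?_
  · rintro i ⟨hi, h⟩
    exact ⟨hf i hi, by rw [hw i hi, h]⟩
  · rintro i j ⟨hi, _⟩ ⟨hj, _⟩ h
    rw [← hgf i hi, ← hgf j hj, h]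
  · rintro j ⟨hj, h⟩
    exact ⟨g j, ⟨hg j hj, by rw [← hw _ (hg j hj), hfg j hj, h]⟩, hfg j hj⟩

theorem GS_congr {ι : Type} {S T : Set ι} {w v : ι → ℤ} (h : ∀ i, i ∈ S ↔ i ∈ T)
    (hw : ∀ i ∈ S, w i = v i) : GS S w = GS T v :=
  GS_bij id id (fun i hi => (h i).1 hi) (fun i hi => (h i).2 hi) (fun _ _ => rfl) (fun _ _ => rfl)
    (fun i hi => (hw i hi).symm)

theorem GS_split {ι : Type} {S : Set ι} {w : ι → ℤ} (h : Adm S w) (P : ι → Prop) :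
    GS S w = GS {i | i ∈ S ∧ P i} w + GS {i | i ∈ S ∧ ¬ P i} w := by
  ext n
  simp only [GS, PowerSeries.coeff_mk, map_add]
  rw [← Nat.cast_add, ← Set.ncard_union_eq ?_ ?_ ?_]
  · congr 2
    ext i
    simp only [Set.mem_ofPred_eq, Set.mem_union]
    tauto
  · rw [Set.disjoint_left]
    rintro i ⟨hi, _⟩ ⟨hj, _⟩
    exact hj.2 hi.2
  · exact (h.fin n).subset fun i hi => ⟨hi.1.1, hi.2⟩
  · exact (h.fin n).subset fun i hi => ⟨hi.1.1, hi.2⟩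

theorem GS_mul {ι κ : Type} {S : Set ι} {T : Set κ} {w : ι → ℤ} {v : κ → ℤ}
    (h : Adm S w) (h' : Adm T v) : GS S w * GS T v = GS (S ×ˢ T) (fun p => w p.1 + v p.2) := by
  classical
  ext n
  rw [PowerSeries.coeff_mul]
  simp only [GS, PowerSeries.coeff_mk]
  have e : {i | i ∈ S ×ˢ T ∧ w i.1 + v i.2 = (n : ℤ)} =
      ⋃ p ∈ (Finset.HasAntidiagonal.antidiagonal n : Set (ℕ × ℕ)),
        {i | i ∈ S ∧ w i = (p.1 : ℤ)} ×ˢ {i | i ∈ T ∧ v i = (p.2 : ℤ)} := by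
    ext ⟨i, j⟩
    simp only [Set.mem_prod, Set.mem_ofPred_eq, Set.mem_iUnion, Finset.mem_coe,
      Finset.HasAntidiagonal.mem_antidiagonal, exists_prop, Prod.exists]
    constructor
    · rintro ⟨⟨hi, hj⟩, hw⟩
      have a := h.1 i hi
      have b := h'.1 j hj
      exact ⟨(w i).toNat, (v j).toNat, by omega, ⟨hi, by omega⟩, ⟨hj, by omega⟩⟩
    · rintro ⟨a, b, hab, ⟨hi, hi'⟩, hj, hj'⟩
      exact ⟨⟨hi, hj⟩, by omega⟩
  rw [e, (Finset.finite_toSet _).ncard_biUnion]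
  · rw [finsum_mem_coe_finset]
    rw [Nat.cast_sum]
    refine Finset.sum_congr rfl fun p _ => ?_
    rw [Set.ncard_prod]
    push_cast
    rfl
  · intro p _
    exact (h.fin _).prod (h'.fin _)
  · rintro p _ q _ hpq
    rw [Function.onFun, Set.disjoint_left]
    rintro ⟨i, j⟩ ⟨hi, hj⟩ ⟨hi', hj'⟩
    apply hpq
    have h1 := hi.2
    have h2 := hi'.2
    have h3 := hj.2
    have h4 := hj'.2
    simp only at h1 h2 h3 h4
    ext
    · omega
    · omega

theorem GS_X {ι : Type} {S : Set ι} {w : ι → ℤ} (h : Adm S w) (k : ℕ) :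
    X ^ k * GS S w = GS S (fun i => w i + k) := by
  ext n
  rw [PowerSeries.coeff_X_pow_mul']
  simp only [GS, PowerSeries.coeff_mk]
  split_ifs with hk
  · congr 3
    ext i
    constructor
    · rintro ⟨a, b⟩; exact ⟨a, by omega⟩
    · rintro ⟨a, b⟩; exact ⟨a, by omega⟩
  · symm
    have : {i | i ∈ S ∧ w i + (k : ℤ) = (n : ℤ)} = ∅ := by
      ext i
      simp only [Set.mem_ofPred_eq, Set.mem_empty_iff_false, iff_false]
      rintro ⟨a, b⟩
      have := h.1 i a
      omega
    rw [this]; simp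

theorem coeff_expand' (p : ℕ) (hp : p ≠ 0) (f : PowerSeries ℤ) (n : ℕ) :
    coeff n (PowerSeries.expand p hp f) = if p ∣ n then coeff (n / p) f else 0 :=
  PowerSeries.coeff_expand p hp f

theorem GS_expand {ι : Type} {S : Set ι} {w : ι → ℤ} (p : ℕ) (hp : p ≠ 0) :
    PowerSeries.expand p hp (GS S w) = GS S (fun i => p * w i) := by
  ext n
  rw [coeff_expand']
  have hp' : (p : ℤ) ≠ 0 := by exact_mod_cast hp
  simp only [GS, PowerSeries.coeff_mk]
  split_ifs with hk
  · obtain ⟨c, rfl⟩ := hk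
    rw [Nat.mul_div_cancel_left _ (Nat.pos_of_ne_zero hp)]
    congr 3
    ext i
    push_cast
    rw [mul_right_inj' hp']
  · symm
    have : {i | i ∈ S ∧ (p : ℤ) * w i = (n : ℤ)} = ∅ := by
      ext i
      simp only [Set.mem_ofPred_eq, Set.mem_empty_iff_false, iff_false]
      rintro ⟨a, b⟩
      exact hk (by exact_mod_cast Dvd.intro _ b)
    rw [this]; simp

/-- substitution `q ↦ -q` -/
noncomputable def ng : PowerSeries ℤ →+* PowerSeries ℤ := PowerSeries.rescale (-1)

theorem coeff_ng (f : PowerSeries ℤ) (n : ℕ) : coeff n (ng f) = (-1) ^ n * coeff n f := by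
  simp [ng, PowerSeries.coeff_rescale]

theorem GS_ng_even {ι : Type} {S : Set ι} {w : ι → ℤ} (h : ∀ i ∈ S, w i % 2 = 0) :
    ng (GS S w) = GS S w := by
  ext n
  rw [coeff_ng]
  rcases Nat.even_or_odd n with hn | hn
  · rw [hn.neg_one_pow, one_mul]
  · have : {i | i ∈ S ∧ w i = (n : ℤ)} = ∅ := by
      ext i
      simp only [Set.mem_ofPred_eq, Set.mem_empty_iff_false, iff_false]
      rintro ⟨a, b⟩
      have := h i a
      obtain ⟨k, rfl⟩ := hn
      omega
    simp [GS, this]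

theorem GS_ng_odd {ι : Type} {S : Set ι} {w : ι → ℤ} (h : ∀ i ∈ S, w i % 2 = 1) :
    ng (GS S w) = - GS S w := by
  ext n
  rw [coeff_ng, map_neg]
  rcases Nat.even_or_odd n with hn | hn
  · have : {i | i ∈ S ∧ w i = (n : ℤ)} = ∅ := by
      ext i
      simp only [Set.mem_ofPred_eq, Set.mem_empty_iff_false, iff_false]
      rintro ⟨a, b⟩
      have := h i a
      obtain ⟨k, rfl⟩ := hn
      omega
    simp [GS, this]
  · rw [hn.neg_one_pow, neg_one_mul]

/-- extraction of the exponents `8n+7` -/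
noncomputable def ex : PowerSeries ℤ →+ PowerSeries ℤ where
  toFun f := PowerSeries.mk fun n => coeff (8 * n + 7) f
  map_zero' := by ext n; simp
  map_add' f g := by ext n; simp

theorem GS_ex {ι κ : Type} {S : Set ι} {T : Set κ} {w : ι → ℤ} {v : κ → ℤ} (f : ι → κ) (g : κ → ι)
    (hf : ∀ i ∈ S, w i % 8 = 7 → f i ∈ T) (hg : ∀ j ∈ T, g j ∈ S)
    (hgf : ∀ i ∈ S, w i % 8 = 7 → g (f i) = i)
    (hfg : ∀ j ∈ T, f (g j) = j) (hw : ∀ j ∈ T, w (g j) = 8 * v j + 7) :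
    ex (GS S w) = GS T v := by
  ext n
  simp only [ex, GS, PowerSeries.coeff_mk, AddMonoidHom.coe_mk, ZeroHom.coe_mk]
  congr 1
  symm
  refine Set.ncard_congr (fun i _ => g i) ?_ ?_ ?_
  · rintro i ⟨hi, h⟩
    exact ⟨hg i hi, by rw [hw i hi, h]; push_cast; ring⟩
  · rintro i j ⟨hi, _⟩ ⟨hj, _⟩ h
    rw [← hfg i hi, ← hfg j hj, h]
  · rintro i ⟨hi, h⟩
    have h7 : w i % 8 = 7 := by rw [h]; push_cast; omega
    refine ⟨f i, ⟨hf i hi h7, ?_⟩, hgf i hi h7⟩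
    have := hw _ (hf i hi h7)
    rw [hgf i hi h7, h] at this
    push_cast at this
    omega


def tri (m : ℤ) : ℤ := m * (m + 1) / 2

theorem two_tri (m : ℤ) : 2 * tri m = m * (m + 1) := by
  unfold tri
  exact Int.mul_ediv_cancel' (Int.even_mul_succ_self m).two_dvd

theorem tri_nonneg (m : ℤ) : 0 ≤ tri m := by
  have := two_tri m
  rcases le_or_gt 0 m with h | h
  · nlinarith
  · nlinarith

theorem adm_sq (k : ℤ) (hk : 0 < k) : Adm Set.univ (fun m : ℤ => k * m ^ 2) := by
  refine adm1 0 (fun m _ => by positivity) fun m _ => ?_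
  have h1 : |m| ≤ m ^ 2 := by
    rw [← sq_abs]
    rcases eq_or_lt_of_le (abs_nonneg m) with h | h
    · rw [← h]; norm_num
    · nlinarith [abs_nonneg m]
  nlinarith [sq_nonneg m]

theorem adm_tri (k : ℤ) (hk : 0 < k) : Adm Set.univ (fun m : ℤ => k * tri m) := by
  refine adm1 1 (fun m _ => mul_nonneg hk.le (tri_nonneg m)) fun m _ => ?_
  have h1 : |m| ≤ tri m + 1 := by
    have := two_tri m
    rw [abs_le]
    constructor
    · nlinarith [sq_nonneg (m+1), sq_nonneg m]
    · rcases le_or_gt m 1 with h | h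
      · have := tri_nonneg m; omega
      · nlinarith
  nlinarith [tri_nonneg m]

theorem phi_GS (k : ℕ) : phi k = GS Set.univ (fun m : ℤ => (k : ℤ) * m ^ 2) := by
  ext n
  simp only [phi, GS, PowerSeries.coeff_mk, Set.mem_univ, true_and]
  congr 3
  ext m
  exact eq_comm

theorem psi_GS (k : ℕ) : psi k = GS {m : ℤ | 0 ≤ m} (fun m : ℤ => (k : ℤ) * tri m) := by
  ext n
  simp only [psi, GS, PowerSeries.coeff_mk, Set.mem_ofPred_eq]
  congr 3
  ext m
  exact and_congr_right fun _ => eq_comm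

theorem psi_two (k : ℕ) (hk : 0 < k) :
    2 * psi k = GS Set.univ (fun m : ℤ => (k : ℤ) * tri m) := by
  rw [GS_split (adm_tri k (by exact_mod_cast hk)) (fun m => 0 ≤ m), two_mul]
  congr 1
  · rw [psi_GS]
    exact GS_congr (fun i => by simp) (fun _ _ => rfl)
  · rw [psi_GS]
    refine GS_bij (fun m => -1 - m) (fun m => -1 - m) ?_ ?_ ?_ ?_ ?_
    · intro i hi; simp at hi ⊢; omega
    · intro i hi; simp at hi ⊢; omega
    · intro i hi; ring
    · intro i hi; ring
    · intro i hi
      have h1 := two_tri i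
      have h2 := two_tri (-1 - i)
      have : tri (-1 - i) = tri i := by nlinarith
      simp only [this]

theorem phi_expand (p : ℕ) (hp : p ≠ 0) (k : ℕ) :
    PowerSeries.expand p hp (phi k) = phi (p * k) := by
  rw [phi_GS, phi_GS, GS_expand]
  exact GS_congr (fun _ => Iff.rfl) (fun i _ => by push_cast; ring)

theorem psi_expand (p : ℕ) (hp : p ≠ 0) (k : ℕ) :
    PowerSeries.expand p hp (psi k) = psi (p * k) := by
  rw [psi_GS, psi_GS, GS_expand]
  exact GS_congr (fun _ => Iff.rfl) (fun i _ => by push_cast; ring)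

theorem ps_ne (f : PowerSeries ℤ) (h : PowerSeries.constantCoeff f ≠ 0) : f ≠ 0 := by
  rintro rfl
  simp at h

theorem exp_two (p : ℕ) (hp : p ≠ 0) : PowerSeries.expand p hp (2 : PowerSeries ℤ) = 2 := 
  map_ofNat (PowerSeries.expand p hp) 2

theorem b3 : psi 1 ^ 2 = phi 1 * psi 2 := by
  have h1 := psi_two 1 (by norm_num)
  have h2 := psi_two 2 (by norm_num)
  have e : (2 * psi 1) * (2 * psi 1) = 2 * (phi 1 * (2 * psi 2)) := by
    rw [h1, h2, phi_GS, GS_mul (adm_tri _ (by norm_num)) (adm_tri _ (by norm_num)),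
      GS_mul (adm_sq _ (by norm_num)) (adm_tri _ (by norm_num)),
      GS_split ((adm_tri _ (by norm_num)).prod (adm_tri _ (by norm_num))) 
        (fun p => (p.1 + p.2) % 2 = 0), two_mul]
    congr 1
    · refine GS_bij (fun p => ((p.1 - p.2) / 2, (p.1 + p.2) / 2)) (fun p => (p.2 + p.1, p.2 - p.1))
        ?_ ?_ ?_ ?_ ?_
      · intro p _; simp
      · rintro ⟨a, b⟩ _; simp; omega
      · rintro ⟨a, b⟩ hi; simp at hi; ext <;> simp <;> omega
      · rintro ⟨a, b⟩ _; ext <;> simp <;> omega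
      · rintro ⟨a, b⟩ hi
        simp at hi
        obtain ⟨c, rfl⟩ : ∃ c, a = 2 * c - b := ⟨(a + b) / 2, by omega⟩
        have e1 : (2 * c - b - b) / 2 = c - b := by omega
        have e2 : (2 * c - b + b) / 2 = c := by omega
        simp only [e1, e2]
        have t1 := two_tri (2 * c - b)
        have t2 := two_tri b
        have t3 := two_tri c
        push_cast
        nlinarith
    · refine GS_bij (fun p => ((-1 - p.1 - p.2) / 2, (-1 - p.1 + p.2) / 2))
        (fun p => (-1 - (p.2 + p.1), p.2 - p.1))
        ?_ ?_ ?_ ?_ ?_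
      · intro p _; simp
      · rintro ⟨a, b⟩ _; simp; omega
      · rintro ⟨a, b⟩ hi; simp at hi; ext <;> simp <;> omega
      · rintro ⟨a, b⟩ _; ext <;> simp <;> omega
      · rintro ⟨a, b⟩ hi
        simp at hi
        obtain ⟨c, rfl⟩ : ∃ c, a = -1 - (2 * c - b) := ⟨(-1 - a + b) / 2, by omega⟩
        have e1 : (-1 - (-1 - (2 * c - b)) - b) / 2 = c - b := by omega
        have e2 : (-1 - (-1 - (2 * c - b)) + b) / 2 = c := by omega
        simp only [e1, e2]
        have t1 := two_tri (-1 - (2 * c - b))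
        have t2 := two_tri b
        have t3 := two_tri c
        push_cast
        nlinarith
  have h4 : (4 : PowerSeries ℤ) ≠ 0 := ps_ne 4 (by rw [map_ofNat]; norm_num)
  refine mul_left_cancel₀ h4 ?_
  linear_combination e

theorem b2 : phi 1 ^ 2 = phi 2 ^ 2 + 4 * X * psi 4 ^ 2 := by
  have h1 := psi_two 4 (by norm_num)
  have e : phi 1 * phi 1 = phi 2 * phi 2 + X ^ 1 * ((2 * psi 4) * (2 * psi 4)) := by
    rw [h1, phi_GS, phi_GS, GS_mul (adm_tri _ (by norm_num)) (adm_tri _ (by norm_num)),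
      GS_mul (adm_sq _ (by norm_num)) (adm_sq _ (by norm_num)),
      GS_mul (adm_sq _ (by norm_num)) (adm_sq _ (by norm_num)),
      GS_X ((adm_tri _ (by norm_num)).prod (adm_tri _ (by norm_num))),
      GS_split ((adm_sq _ (by norm_num)).prod (adm_sq _ (by norm_num))) 
        (fun p => (p.1 + p.2) % 2 = 0)]
    congr 1
    · refine GS_bij (fun p => ((p.1 - p.2) / 2, (p.1 + p.2) / 2)) (fun p => (p.2 + p.1, p.2 - p.1))
        ?_ ?_ ?_ ?_ ?_
      · intro p _; simp
      · rintro ⟨a, b⟩ _; simp; omega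
      · rintro ⟨a, b⟩ hi; simp at hi; ext <;> simp <;> omega
      · rintro ⟨a, b⟩ _; ext <;> simp <;> omega
      · rintro ⟨a, b⟩ hi
        simp at hi
        obtain ⟨c, rfl⟩ : ∃ c, a = 2 * c - b := ⟨(a + b) / 2, by omega⟩
        have e1 : (2 * c - b - b) / 2 = c - b := by omega
        have e2 : (2 * c - b + b) / 2 = c := by omega
        simp only [e1, e2]
        push_cast
        ring
    · refine GS_bij (fun p => ((p.1 - p.2 - 1) / 2, (p.1 + p.2 - 1) / 2))
        (fun p => (p.2 + p.1 + 1, p.2 - p.1))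
        ?_ ?_ ?_ ?_ ?_
      · intro p _; simp
      · rintro ⟨a, b⟩ _; simp; omega
      · rintro ⟨a, b⟩ hi; simp at hi; ext <;> simp <;> omega
      · rintro ⟨a, b⟩ _; ext <;> simp <;> omega
      · rintro ⟨a, b⟩ hi
        simp at hi
        obtain ⟨c, rfl⟩ : ∃ c, a = 2 * c - b + 1 := ⟨(a + b - 1) / 2, by omega⟩
        have e1 : (2 * c - b + 1 - b - 1) / 2 = c - b := by omega
        have e2 : (2 * c - b + 1 + b - 1) / 2 = c := by omega
        simp only [e1, e2]
        have t2 := two_tri (c - b)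
        have t3 := two_tri c
        push_cast
        nlinarith
  linear_combination e

/-- norm form of `Z[(1+√-7)/2]` -/
def nf (p : ℤ × ℤ) : ℤ := p.1 ^ 2 + p.1 * p.2 + 2 * p.2 ^ 2

theorem adm_nf : Adm Set.univ nf := by
  refine ⟨fun p _ => by unfold nf; nlinarith [sq_nonneg (2 * p.1 + p.2), sq_nonneg p.2], fun n => ?_⟩
  refine ((Set.finite_Icc (-(n + 1)) (n + 1)).prod (Set.finite_Icc (-(n + 1)) (n + 1))).subset ?_
  rintro ⟨x, y⟩ ⟨_, h⟩
  simp only [nf] at h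
  simp only [Set.mem_prod, Set.mem_Icc]
  refine ⟨⟨?_, ?_⟩, ⟨?_, ?_⟩⟩ <;>
    nlinarith [sq_nonneg (x + 1), sq_nonneg (x - 1), sq_nonneg (x + 2 * y), sq_nonneg (y + 1),
      sq_nonneg (y - 1), sq_nonneg (2 * x + y)]

/-- the modular equation of degree seven -/
theorem deg7 : phi 1 * phi 7 =
    PowerSeries.expand 2 two_ne_zero (ng (phi 1 * phi 7)) + 2 * X * psi 1 * psi 7 := by
  set Cc := GS Set.univ nf with hCc
  set O := GS {p : ℤ × ℤ | p.1 % 2 = 1 ∧ p.2 % 2 = 0} nf with hO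
  set W := GS Set.univ (fun p : ℤ × ℤ => (1 : ℤ) * tri p.1 + (7 : ℤ) * tri p.2 + 1) with hW
  have hW' : 4 * X * psi 1 * psi 7 = W := by
    have e : X ^ 1 * ((2 * psi 1) * (2 * psi 7)) = W := by
      rw [psi_two 1 (by norm_num), psi_two 7 (by norm_num),
        GS_mul (adm_tri _ (by norm_num)) (adm_tri _ (by norm_num)),
        GS_X ((adm_tri _ (by norm_num)).prod (adm_tri _ (by norm_num)))]
      exact GS_congr (fun i => by simp) (fun i _ => by push_cast; ring)
    linear_combination e
  -- pieces
  have both : GS {p : ℤ × ℤ | p.1 % 2 = 0 ∧ p.2 % 2 = 0} nf =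
      PowerSeries.expand 4 four_ne_zero Cc := by
    rw [hCc, GS_expand]
    refine GS_bij (fun p => (p.1 / 2, p.2 / 2)) (fun p => (2 * p.1, 2 * p.2)) ?_ ?_ ?_ ?_ ?_
    · intro p _; simp
    · rintro ⟨a, b⟩ _; simp
    · rintro ⟨a, b⟩ hi; simp at hi; ext <;> simp <;> omega
    · rintro ⟨a, b⟩ _; simp
    · rintro ⟨a, b⟩ ⟨h1, h2⟩
      obtain ⟨c, rfl⟩ : ∃ c, a = 2 * c := ⟨a / 2, by simp at h1; omega⟩
      obtain ⟨d, rfl⟩ : ∃ c, b = 2 * c := ⟨b / 2, by simp at h2; omega⟩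
      simp [nf]; ring
  have hA : GS {p : ℤ × ℤ | p.1 % 2 = 0} nf = PowerSeries.expand 2 two_ne_zero Cc := by
    rw [hCc, GS_expand]
    refine GS_bij (fun p => (p.2, p.1 / 2)) (fun p => (2 * p.2, p.1)) ?_ ?_ ?_ ?_ ?_
    · intro p _; simp
    · rintro ⟨a, b⟩ _; simp
    · rintro ⟨a, b⟩ hi; simp at hi; ext <;> simp <;> omega
    · rintro ⟨a, b⟩ _; simp
    · rintro ⟨a, b⟩ h1
      obtain ⟨c, rfl⟩ : ∃ c, a = 2 * c := ⟨a / 2, by simp at h1; omega⟩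
      simp [nf]; ring
  have hB : GS {p : ℤ × ℤ | (p.1 + p.2) % 2 = 0} nf = PowerSeries.expand 2 two_ne_zero Cc := by
    rw [hCc, GS_expand]
    refine GS_bij (fun p => (p.1 - (p.1 + p.2), (p.1 + p.2) / 2))
      (fun p => (p.1 + 2 * p.2, 2 * p.2 - (p.1 + 2 * p.2))) ?_ ?_ ?_ ?_ ?_
    · intro p _; simp
    · rintro ⟨a, b⟩ _; simp
    · rintro ⟨a, b⟩ hi; simp at hi; ext <;> simp <;> omega
    · rintro ⟨a, b⟩ _; simp
    · rintro ⟨a, b⟩ h1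
      obtain ⟨c, rfl⟩ : ∃ c, a = 2 * c - b := ⟨(a + b) / 2, by simp at h1; omega⟩
      have : (2 * c - b + b) / 2 = c := by omega
      simp only [nf, this]; push_cast; ring
  have hV : phi 1 * phi 7 = PowerSeries.expand 4 four_ne_zero Cc + O := by
    rw [← both, phi_GS, phi_GS, GS_mul (adm_sq _ (by norm_num)) (adm_sq _ (by norm_num))]
    have : GS (Set.univ ×ˢ Set.univ) (fun p : ℤ × ℤ => ((1 : ℕ) : ℤ) * p.1 ^ 2 + ((7 : ℕ) : ℤ) * p.2 ^ 2)
        = GS {p : ℤ × ℤ | p.2 % 2 = 0} nf := by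
      refine GS_bij (fun p => (p.1 - p.2, 2 * p.2)) (fun p => (p.1 + p.2 / 2, p.2 / 2)) ?_ ?_ ?_ ?_ ?_
      · intro p _; simp
      · rintro ⟨a, b⟩ _; simp
      · rintro ⟨a, b⟩ hi; simp
      · rintro ⟨a, b⟩ h; simp at h; ext <;> simp; omega
      · rintro ⟨a, b⟩ h1; simp [nf]; ring
    rw [this, GS_split (adm_nf.mono (Set.subset_univ _)) (fun p => p.1 % 2 = 0)]
    congr 1
    · exact GS_congr (fun p => by simp; tauto) (fun _ _ => rfl)
    · exact GS_congr (fun p => by simp; tauto) (fun _ _ => rfl)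
  have hC : Cc = 2 * PowerSeries.expand 2 two_ne_zero Cc - PowerSeries.expand 4 four_ne_zero Cc + O := by
    have s1 := GS_split adm_nf (fun p => p.1 % 2 = 0)
    have s2 := GS_split (S := {p : ℤ × ℤ | p.1 % 2 = 1}) (adm_nf.mono (Set.subset_univ _))
      (fun p => p.2 % 2 = 0)
    have s3 := GS_split (S := {p : ℤ × ℤ | (p.1 + p.2) % 2 = 0}) (adm_nf.mono (Set.subset_univ _))
      (fun p => p.1 % 2 = 0)
    have c1 : GS {i : ℤ × ℤ | i ∈ Set.univ ∧ i.1 % 2 = 0} nf = GS {p : ℤ × ℤ | p.1 % 2 = 0} nf :=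
      GS_congr (fun p => by simp) (fun _ _ => rfl)
    have c2 : GS {i : ℤ × ℤ | i ∈ Set.univ ∧ ¬ i.1 % 2 = 0} nf = GS {p : ℤ × ℤ | p.1 % 2 = 1} nf :=
      GS_congr (fun p => by simp) (fun _ _ => rfl)
    have c3 : GS {i : ℤ × ℤ | i ∈ {p : ℤ × ℤ | p.1 % 2 = 1} ∧ i.2 % 2 = 0} nf = O :=
      GS_congr (fun p => by simp) (fun _ _ => rfl)
    have c4 : GS {i : ℤ × ℤ | i ∈ {p : ℤ × ℤ | p.1 % 2 = 1} ∧ ¬ i.2 % 2 = 0} nf =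
        GS {i : ℤ × ℤ | i ∈ {p : ℤ × ℤ | (p.1 + p.2) % 2 = 0} ∧ ¬ i.1 % 2 = 0} nf :=
      GS_congr (fun p => by simp; omega) (fun _ _ => rfl)
    have c5 : GS {i : ℤ × ℤ | i ∈ {p : ℤ × ℤ | (p.1 + p.2) % 2 = 0} ∧ i.1 % 2 = 0} nf =
        GS {p : ℤ × ℤ | p.1 % 2 = 0 ∧ p.2 % 2 = 0} nf :=
      GS_congr (fun p => by simp; omega) (fun _ _ => rfl)
    rw [c1, c2, hA] at s1
    rw [c3, c4] at s2
    rw [c5, both, hB] at s3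
    linear_combination s1 + s2 - s3
  have hW2 : PowerSeries.expand 2 two_ne_zero W =
      2 * PowerSeries.expand 2 two_ne_zero Cc - 2 * PowerSeries.expand 4 four_ne_zero Cc := by
    have e : PowerSeries.expand 2 two_ne_zero W = GS {p : ℤ × ℤ | ¬ p.2 % 2 = 0} nf := by
      rw [hW, GS_expand]
      refine GS_bij (fun p => (p.1 - p.2, 2 * p.2 + 1)) (fun p => (p.1 + (p.2 - 1) / 2, (p.2 - 1) / 2))
        ?_ ?_ ?_ ?_ ?_
      · intro p _; simp
      · rintro ⟨a, b⟩ _; simp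
      · rintro ⟨a, b⟩ hi; simp
      · rintro ⟨a, b⟩ h; simp at h; ext <;> simp; omega
      · rintro ⟨a, b⟩ h1
        have t1 := two_tri a
        have t2 := two_tri b
        simp only [nf]; push_cast; nlinarith
    have s1 := GS_split adm_nf (fun p => p.2 % 2 = 0)
    have s2 := GS_split (S := {p : ℤ × ℤ | p.2 % 2 = 0}) (adm_nf.mono (Set.subset_univ _))
      (fun p => p.1 % 2 = 0)
    have c1 : GS {i : ℤ × ℤ | i ∈ Set.univ ∧ i.2 % 2 = 0} nf = GS {p : ℤ × ℤ | p.2 % 2 = 0} nf :=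
      GS_congr (fun p => by simp) (fun _ _ => rfl)
    have c2 : GS {i : ℤ × ℤ | i ∈ Set.univ ∧ ¬ i.2 % 2 = 0} nf = GS {p : ℤ × ℤ | ¬ p.2 % 2 = 0} nf :=
      GS_congr (fun p => by simp) (fun _ _ => rfl)
    have c3 : GS {i : ℤ × ℤ | i ∈ {p : ℤ × ℤ | p.2 % 2 = 0} ∧ i.1 % 2 = 0} nf =
        GS {p : ℤ × ℤ | p.1 % 2 = 0 ∧ p.2 % 2 = 0} nf :=
      GS_congr (fun p => by simp; tauto) (fun _ _ => rfl)
    have c4 : GS {i : ℤ × ℤ | i ∈ {p : ℤ × ℤ | p.2 % 2 = 0} ∧ ¬ i.1 % 2 = 0} nf = O :=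
      GS_congr (fun p => by simp; tauto) (fun _ _ => rfl)
    rw [c1, c2, ← e] at s1
    rw [c3, c4, both] at s2
    linear_combination hC - s1 - s2
  have e24 : ∀ f : PowerSeries ℤ, PowerSeries.expand 2 two_ne_zero (PowerSeries.expand 2 two_ne_zero f)
      = PowerSeries.expand 4 four_ne_zero f := fun f =>
    (PowerSeries.expand_mul 2 two_ne_zero 2 two_ne_zero f).symm
  have inj : ∀ f g : PowerSeries ℤ, PowerSeries.expand 2 two_ne_zero f =
      PowerSeries.expand 2 two_ne_zero g → f = g := by
    intro f g h
    ext n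
    rw [← PowerSeries.coeff_expand_mul 2 two_ne_zero f, h, PowerSeries.coeff_expand_mul]
  have hW3 : W = 2 * Cc - 2 * PowerSeries.expand 2 two_ne_zero Cc := by
    apply inj
    rw [hW2, map_sub, map_mul, map_mul, e24, exp_two]
  have hng : ng (phi 1 * phi 7) = PowerSeries.expand 4 four_ne_zero Cc - O := by
    rw [hV, map_add, ← both, GS_ng_even, hO, GS_ng_odd]
    · ring
    · rintro ⟨a, b⟩ ⟨h1, h2⟩
      obtain ⟨c, rfl⟩ : ∃ c, a = 2 * c + 1 := ⟨a / 2, by simp at h1; omega⟩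
      obtain ⟨d, rfl⟩ : ∃ c, b = 2 * c := ⟨b / 2, by simp at h2; omega⟩
      simp only [nf]; ring_nf; omega
    · rintro ⟨a, b⟩ ⟨h1, h2⟩
      obtain ⟨c, rfl⟩ : ∃ c, a = 2 * c := ⟨a / 2, by simp at h1; omega⟩
      obtain ⟨d, rfl⟩ : ∃ c, b = 2 * c := ⟨b / 2, by simp at h2; omega⟩
      simp only [nf]; ring_nf; omega
  have hng2 : ng (phi 1 * phi 7) = 2 * PowerSeries.expand 2 two_ne_zero Cc - Cc := by
    rw [hng]; linear_combination hC
  have h2 : (2 : PowerSeries ℤ) ≠ 0 := ps_ne 2 (by rw [map_ofNat]; norm_num)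
  refine mul_left_cancel₀ h2 ?_
  rw [hng2, map_sub, map_mul, e24, hV]
  rw [exp_two]
  linear_combination -hW' - hW3 - 2 * hC


/-- theta function `f(q^(7+2k), q^(7-2k))` -/
noncomputable def ff (k : ℤ) : PowerSeries ℤ := GS Set.univ (fun n : ℤ => 7 * n ^ 2 + 2 * k * n)

theorem adm_ff (k : ℤ) (h1 : 0 < k) (h2 : k < 4) :
    Adm Set.univ (fun n : ℤ => 7 * n ^ 2 + 2 * k * n) := by
  have key : ∀ n : ℤ, |n| ≤ 7 * n ^ 2 + 2 * k * n := by
    intro n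
    rw [← sq_abs]
    have h3 : -(6 * |n|) ≤ 2 * k * n := by
      rcases abs_cases n with ⟨h, h'⟩ | ⟨h, h'⟩ <;> rw [h] <;> nlinarith
    have h4 : |n| ≤ |n| ^ 2 := by
      rcases eq_or_lt_of_le (abs_nonneg n) with h | h
      · rw [← h]; norm_num
      · nlinarith [abs_nonneg n]
    nlinarith
  exact adm1 0 (fun n _ => (abs_nonneg n).trans (key n)) (fun n _ => by linarith [key n])

theorem sq8 (m : ℤ) : (m % 4 = 0 ∧ m ^ 2 % 8 = 0) ∨ (m % 4 = 2 ∧ m ^ 2 % 8 = 4) ∨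
    (m % 2 = 1 ∧ m ^ 2 % 8 = 1) := by
  rcases (by omega : m % 4 = 0 ∨ m % 4 = 2 ∨ m % 4 = 1 ∨ m % 4 = 3) with h | h | h | h
  · obtain ⟨c, rfl⟩ : ∃ c, m = 4 * c := ⟨m / 4, by omega⟩
    left; refine ⟨h, ?_⟩; ring_nf; omega
  · obtain ⟨c, rfl⟩ : ∃ c, m = 4 * c + 2 := ⟨m / 4, by omega⟩
    right; left; refine ⟨h, ?_⟩; ring_nf; omega
  · obtain ⟨c, rfl⟩ : ∃ c, m = 4 * c + 1 := ⟨m / 4, by omega⟩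
    right; right; refine ⟨by omega, ?_⟩; ring_nf; omega
  · obtain ⟨c, rfl⟩ : ∃ c, m = 4 * c + 3 := ⟨m / 4, by omega⟩
    right; right; refine ⟨by omega, ?_⟩; ring_nf; omega

theorem GS_ex_zero {ι : Type} {S : Set ι} {w : ι → ℤ} (h : ∀ i ∈ S, w i % 8 ≠ 7) :
    ex (GS S w) = 0 := by
  ext n
  have : {i | i ∈ S ∧ w i = ((8 * n + 7 : ℕ) : ℤ)} = ∅ := by
    ext i
    simp only [Set.mem_ofPred_eq, Set.mem_empty_iff_false, iff_false]
    rintro ⟨a, b⟩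
    exact h i a (by rw [b]; push_cast; omega)
  simp only [ex, GS, PowerSeries.coeff_mk, AddMonoidHom.coe_mk, ZeroHom.coe_mk, this]
  simp

/-- `2ψ(q^7)φ(q^k)²` -/
theorem A_GS (k : ℕ) (hk : 0 < k) : (2 * psi 7) * (phi k * phi k) =
    GS Set.univ (fun p : ℤ × ℤ × ℤ => 7 * tri p.1 + (k * p.2.1 ^ 2 + k * p.2.2 ^ 2)) := by
  have hk' : (0 : ℤ) < k := by exact_mod_cast hk
  rw [psi_two 7 (by norm_num), phi_GS, GS_mul (adm_sq _ hk') (adm_sq _ hk'),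
    GS_mul (adm_tri _ (by norm_num)) ((adm_sq _ hk').prod (adm_sq _ hk'))]
  exact GS_congr (fun i => by simp) (fun i _ => by push_cast; ring)

theorem P_GS (k : ℕ) (hk : 0 < k) : phi 7 * (phi k * phi k) =
    GS Set.univ (fun p : ℤ × ℤ × ℤ => 7 * p.1 ^ 2 + (k * p.2.1 ^ 2 + k * p.2.2 ^ 2)) := by
  have hk' : (0 : ℤ) < k := by exact_mod_cast hk
  rw [phi_GS 7, phi_GS, GS_mul (adm_sq _ hk') (adm_sq _ hk'),
    GS_mul (adm_sq _ (by norm_num)) ((adm_sq _ hk').prod (adm_sq _ hk'))]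
  exact GS_congr (fun i => by simp) (fun i _ => by push_cast; ring)

theorem P_adm (k : ℕ) (hk : 0 < k) : Adm Set.univ
    (fun p : ℤ × ℤ × ℤ => 7 * p.1 ^ 2 + ((k : ℤ) * p.2.1 ^ 2 + k * p.2.2 ^ 2)) := by
  have hk' : (0 : ℤ) < k := by exact_mod_cast hk
  exact ((adm_sq 7 (by norm_num)).prod ((adm_sq _ hk').prod (adm_sq _ hk'))).mono (by simp)

theorem exB : ex (phi 7 * (phi 1 * phi 1)) = (2 * psi 7) * (phi 1 * phi 1) := by
  rw [P_GS 1 one_pos, A_GS 1 one_pos]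
  refine GS_ex (fun p => ((p.1 - 1) / 2, (p.2.1 + p.2.2) / 4, (p.2.1 - p.2.2) / 4))
    (fun p => (2 * p.1 + 1, 2 * (p.2.1 + p.2.2), 2 * (p.2.1 - p.2.2))) ?_ ?_ ?_ ?_ ?_
  · simp
  · simp
  · rintro ⟨z, x, y⟩ _ h
    simp at h
    rcases sq8 x with hx | hx | hx <;> rcases sq8 y with hy | hy | hy <;>
      rcases sq8 z with hz | hz | hz <;>
      first | (exfalso; omega) | (ext <;> simp <;> omega)
  · rintro ⟨z, x, y⟩ _
    ext <;> simp <;> omega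
  · rintro ⟨z, x, y⟩ _
    have := two_tri z
    simp only; push_cast; nlinarith

theorem exA : ex (phi 7 * (phi 7 * phi 7)) = 3 * ((2 * psi 7) * (phi 7 * phi 7)) := by
  rw [P_GS 7 (by norm_num), A_GS 7 (by norm_num), GS_split (P_adm 7 (by norm_num)) (fun p => p.1 % 2 = 1),
    GS_split ((P_adm 7 (by norm_num)).mono (Set.subset_univ _) :
      Adm {i : ℤ × ℤ × ℤ | i ∈ Set.univ ∧ ¬ i.1 % 2 = 1} _) (fun p => p.2.1 % 2 = 1),
    map_add, map_add]
  have e : ∀ f g h k : PowerSeries ℤ, f = k → g = k → h = k → f + (g + h) = 3 * k := by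
    rintro f g h k rfl rfl rfl; ring
  apply e
  · refine GS_ex (fun p => ((p.1 - 1) / 2, (p.2.1 + p.2.2) / 4, (p.2.1 - p.2.2) / 4))
      (fun p => (2 * p.1 + 1, 2 * (p.2.1 + p.2.2), 2 * (p.2.1 - p.2.2))) ?_ ?_ ?_ ?_ ?_
    · simp
    · rintro ⟨z, x, y⟩ _; simp
    · rintro ⟨z, x, y⟩ h' h
      simp at h h'
      rcases sq8 x with hx | hx | hx <;> rcases sq8 y with hy | hy | hy <;>
        rcases sq8 z with hz | hz | hz <;>
        first | (exfalso; omega) | (ext <;> simp <;> omega)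
    · rintro ⟨z, x, y⟩ _
      ext <;> simp <;> omega
    · rintro ⟨z, x, y⟩ _
      have := two_tri z
      simp only; push_cast; nlinarith
  · refine GS_ex (fun p => ((p.2.1 - 1) / 2, (p.1 + p.2.2) / 4, (p.1 - p.2.2) / 4))
      (fun p => (2 * (p.2.1 + p.2.2), 2 * p.1 + 1, 2 * (p.2.1 - p.2.2))) ?_ ?_ ?_ ?_ ?_
    · simp
    · rintro ⟨z, x, y⟩ _; simp
    · rintro ⟨z, x, y⟩ h' h
      simp at h h'
      rcases sq8 x with hx | hx | hx <;> rcases sq8 y with hy | hy | hy <;>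
        rcases sq8 z with hz | hz | hz <;>
        first | (exfalso; omega) | (ext <;> simp <;> omega)
    · rintro ⟨z, x, y⟩ _
      ext <;> simp <;> omega
    · rintro ⟨z, x, y⟩ _
      have := two_tri z
      simp only; push_cast; nlinarith
  · refine GS_ex (fun p => ((p.2.2 - 1) / 2, (p.1 + p.2.1) / 4, (p.1 - p.2.1) / 4))
      (fun p => (2 * (p.2.1 + p.2.2), 2 * (p.2.1 - p.2.2), 2 * p.1 + 1)) ?_ ?_ ?_ ?_ ?_
    · simp
    · rintro ⟨z, x, y⟩ _; simp
    · rintro ⟨z, x, y⟩ h' h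
      simp at h h'
      rcases sq8 x with hx | hx | hx <;> rcases sq8 y with hy | hy | hy <;>
        rcases sq8 z with hz | hz | hz <;>
        first | (exfalso; omega) | (ext <;> simp <;> omega)
    · rintro ⟨z, x, y⟩ _
      ext <;> simp <;> omega
    · rintro ⟨z, x, y⟩ _
      have := two_tri z
      simp only; push_cast; nlinarith

theorem exC : ex (phi 1 * PowerSeries.expand 2 two_ne_zero (ng (phi 1 * phi 7))) =
    - (4 * X * psi 14 * psi 1 * phi 1) := by
  have a2 : Adm Set.univ (fun p : ℤ × ℤ => p.1 ^ 2 + 7 * p.2 ^ 2) := by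
    have a1 := (adm_sq 1 (by norm_num)).prod (adm_sq 7 (by norm_num))
    exact a1.image id (fun _ _ => by simp) (fun _ _ _ _ h => h) (fun _ _ => by simp)
  have hV : phi 1 * phi 7 = GS Set.univ (fun p : ℤ × ℤ => p.1 ^ 2 + 7 * p.2 ^ 2) := by
    rw [phi_GS, phi_GS, GS_mul (adm_sq _ (by norm_num)) (adm_sq _ (by norm_num))]
    exact GS_congr (fun i => by simp) (fun i _ => by push_cast; ring)
  have a3 : ∀ S : Set (ℤ × ℤ), Adm S (fun p : ℤ × ℤ => ((2 : ℕ) : ℤ) * (p.1 ^ 2 + 7 * p.2 ^ 2)) := by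
    intro S
    refine ⟨fun p _ => by positivity, fun n => (a2.2 n).subset ?_⟩
    rintro ⟨x, y⟩ ⟨_, h⟩
    refine ⟨by simp, ?_⟩
    simp only at h ⊢
    push_cast at h
    nlinarith [sq_nonneg x, sq_nonneg y]
  rw [hV, GS_split a2 (fun p => (p.1 ^ 2 + 7 * p.2 ^ 2) % 2 = 0), map_add, GS_ng_even, GS_ng_odd,
    map_add, map_neg, mul_add, mul_neg, map_add, map_neg, GS_expand, GS_expand, phi_GS,
    GS_mul (adm_sq _ (by norm_num)) (a3 _), GS_mul (adm_sq _ (by norm_num)) (a3 _),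
    GS_ex_zero, zero_add]
  · congr 1
    have : 4 * X * psi 14 * psi 1 * phi 1 = X ^ 1 * ((2 * psi 14) * ((2 * psi 1) * phi 1)) := by ring
    rw [← phi_GS, this, psi_two 14 (by norm_num), psi_two 1 (by norm_num), phi_GS,
      GS_mul (adm_tri _ (by norm_num)) (adm_sq _ (by norm_num)),
      GS_mul (adm_tri _ (by norm_num)) ((adm_tri _ (by norm_num)).prod (adm_sq _ (by norm_num))),
      GS_X ((adm_tri _ (by norm_num)).prod ((adm_tri _ (by norm_num)).prod (adm_sq _ (by norm_num))))]
    refine GS_ex (fun p => ((p.2.2 - 1) / 2, (p.1 - 1) / 2, p.2.1 / 2))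
      (fun p => (2 * p.2.1 + 1, 2 * p.2.2, 2 * p.1 + 1)) ?_ ?_ ?_ ?_ ?_
    · simp
    · rintro ⟨b, c, a⟩ _
      simp
      ring_nf; omega
    · rintro ⟨c, a, b⟩ h' h
      simp at h h'
      rcases sq8 a with hx | hx | hx <;> rcases sq8 b with hy | hy | hy <;>
        rcases sq8 c with hz | hz | hz <;>
        first | (exfalso; omega) | (ext <;> simp <;> omega)
    · rintro ⟨z, x, y⟩ _
      ext <;> simp
    · rintro ⟨z, x, y⟩ _
      have := two_tri z
      have := two_tri x
      simp only; push_cast; nlinarith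
  · rintro ⟨c, a, b⟩ ⟨_, h'⟩
    simp at h' ⊢
    rcases sq8 a with hx | hx | hx <;> rcases sq8 b with hy | hy | hy <;>
        rcases sq8 c with hz | hz | hz <;> omega
  · rintro ⟨a, b⟩ ⟨_, h'⟩
    simp at h' ⊢
    omega
  · rintro ⟨a, b⟩ ⟨_, h'⟩
    simp at h' ⊢
    omega


theorem Adm.addc {ι : Type} {S : Set ι} {w : ι → ℤ} (h : Adm S w) (k : ℕ) :
    Adm S (fun i => w i + k) :=
  ⟨fun i hi => add_nonneg (h.1 i hi) (by positivity), fun n => (h.2 n).subset fun i hi =>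
    ⟨hi.1, by have := hi.2; simp only at this; omega⟩⟩

def pent (m : ℤ) : ℤ := m * (3 * m + 1) / 2

theorem two_pent (m : ℤ) : 2 * pent m = m * (3 * m + 1) := by
  unfold pent
  refine Int.mul_ediv_cancel' ?_
  rcases Int.even_or_odd' m with ⟨c, rfl | rfl⟩
  · exact ⟨c * (3 * (2 * c) + 1), by ring⟩
  · exact ⟨(2 * c + 1) * (3 * c + 2), by ring⟩

theorem abs_le_sq (n : ℤ) : |n| ≤ n ^ 2 := by
  rw [← sq_abs]
  rcases eq_or_lt_of_le (abs_nonneg n) with h | h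
  · rw [← h]; norm_num
  · nlinarith [abs_nonneg n]

theorem adm_fA : Adm Set.univ (fun m : ℤ => 7 * pent m) := by
  have key : ∀ n : ℤ, |n| ≤ 7 * pent n := by
    intro n
    have h1 := two_pent n
    have h2 := abs_le_sq n
    have h3 := neg_abs_le n
    nlinarith [abs_nonneg n]
  exact adm1 0 (fun n _ => (abs_nonneg n).trans (key n)) (fun n _ => by linarith [key n])

theorem adm_fB : Adm Set.univ (fun m : ℤ => m * (3 * m + 2)) := by
  have key : ∀ n : ℤ, |n| ≤ n * (3 * n + 2) := by
    intro n
    have h2 := abs_le_sq n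
    have h3 := neg_abs_le n
    nlinarith [abs_nonneg n]
  exact adm1 0 (fun n _ => (abs_nonneg n).trans (key n)) (fun n _ => by linarith [key n])

theorem fA_GS : fA 7 = GS Set.univ (fun m : ℤ => 7 * pent m) := by
  ext n
  simp only [fA, GS, PowerSeries.coeff_mk, Set.mem_univ, true_and]
  congr 3
  ext m
  exact eq_comm

theorem fB_GS : fB 1 = GS Set.univ (fun m : ℤ => m * (3 * m + 2)) := by
  ext n
  simp only [fB, GS, PowerSeries.coeff_mk, Set.mem_univ, true_and]
  congr 3
  ext m
  simp only [Nat.cast_one, one_mul]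
  exact eq_comm

def wD (p : ℤ × ℤ × ℤ) : ℤ :=
  2 * tri p.1 + 3 * tri p.2.1 - 5 * p.2.1 - 7 * p.2.1 * p.2.2 + 21 * tri p.2.2 + 2

theorem wD_norm (a u e : ℤ) : 7 * (8 * wD (a, u, e) + 7) =
    (3 * (2 * a + 1 + u) + 7 * (2 * e + 1 - u)) ^ 2 + (-(2 * a + 1 + u) + 7 * (2 * e + 1 - u)) ^ 2
    + (7 * (2 * a + 1) - 5 * (2 * a + 1 + u) - 7 * (2 * e + 1 - u)) ^ 2 := by
  simp only [wD]
  linear_combination 56 * two_tri a + 84 * two_tri u + 588 * two_tri e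

theorem adm_wD : Adm Set.univ wD := by
  have h0 : ∀ p : ℤ × ℤ × ℤ, 0 ≤ wD p := by
    rintro ⟨a, u, e⟩
    have := wD_norm a u e
    have h : (0 : ℤ) ≤ 7 * (8 * wD (a, u, e) + 7) := by rw [this]; positivity
    omega
  refine ⟨fun p _ => h0 p, fun n => ?_⟩
  have A := (adm_sq 1 one_pos).prod ((adm_sq 1 one_pos).prod (adm_sq 1 one_pos))
  refine Set.Finite.of_finite_image (f := fun p : ℤ × ℤ × ℤ =>
    ((3 * (2 * p.1 + 1 + p.2.1) + 7 * (2 * p.2.2 + 1 - p.2.1),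
     (-(2 * p.1 + 1 + p.2.1) + 7 * (2 * p.2.2 + 1 - p.2.1),
     7 * (2 * p.1 + 1) - 5 * (2 * p.1 + 1 + p.2.1) - 7 * (2 * p.2.2 + 1 - p.2.1))) : ℤ × ℤ × ℤ))
    ((A.2 (7 * (8 * n + 7))).subset ?_) ?_
  · rintro _ ⟨⟨a, u, e⟩, ⟨_, h⟩, rfl⟩
    refine ⟨by simp, ?_⟩
    have := wD_norm a u e
    simp only
    linarith
  · rintro ⟨a, u, e⟩ _ ⟨a', u', e'⟩ _ h
    simp only [Prod.mk.injEq] at h ⊢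
    omega

theorem L1 : (2 * psi 2) * (X ^ 2 * ((2 * psi 21) * phi 3)) =
    GS {p : ℤ × ℤ × ℤ | p.2.1 % 3 = 0} wD := by
  rw [psi_two 2 (by norm_num), psi_two 21 (by norm_num), phi_GS,
    GS_mul (adm_tri _ (by norm_num)) (adm_sq _ (by norm_num)),
    GS_X ((adm_tri _ (by norm_num)).prod (adm_sq _ (by norm_num))),
    GS_mul (adm_tri _ (by norm_num)) (((adm_tri _ (by norm_num)).prod (adm_sq _ (by norm_num))).addc 2)]
  refine GS_bij (fun p => (p.1, 3 * p.2.2, p.2.1 + p.2.2))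
    (fun p => (p.1, p.2.2 - p.2.1 / 3, p.2.1 / 3)) ?_ ?_ ?_ ?_ ?_
  · rintro ⟨a, b, c⟩ _; simp
  · simp
  · rintro ⟨a, b, c⟩ _; ext <;> simp
  · rintro ⟨a, b, c⟩ h; simp at h; ext <;> simp; omega
  · rintro ⟨a, b, c⟩ _
    simp only [wD]
    push_cast
    have h1 := two_tri (3 * c)
    have h2 := two_tri (b + c)
    have h3 := two_tri b
    nlinarith

theorem L2 : (2 * psi 2) * (fB 1 * fA 7) =
    GS {p : ℤ × ℤ × ℤ | p.2.1 % 3 = 1} wD := by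
  rw [psi_two 2 (by norm_num), fA_GS, fB_GS, GS_mul adm_fB adm_fA, 
    GS_mul (adm_tri _ (by norm_num)) (adm_fB.prod adm_fA)]
  refine GS_bij (fun p => (p.1, 3 * p.2.1 + 1, p.2.1 + p.2.2))
    (fun p => (p.1, p.2.1 / 3, p.2.2 - p.2.1 / 3)) ?_ ?_ ?_ ?_ ?_
  · rintro ⟨a, b, c⟩ _; simp
  · simp
  · rintro ⟨a, b, c⟩ _; ext <;> simp <;> omega
  · rintro ⟨a, b, c⟩ h; simp at h; ext <;> simp; omega
  · rintro ⟨a, b, c⟩ _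
    simp only [wD]
    push_cast
    have h1 := two_tri (3 * b + 1)
    have h2 := two_tri (b + c)
    have h3 := two_pent c
    nlinarith

theorem L3 : (2 * psi 2) * (fB 1 * fA 7) =
    GS {p : ℤ × ℤ × ℤ | p.2.1 % 3 = 2} wD := by
  rw [psi_two 2 (by norm_num), fA_GS, fB_GS, GS_mul adm_fB adm_fA, 
    GS_mul (adm_tri _ (by norm_num)) (adm_fB.prod adm_fA)]
  refine GS_bij (fun p => (p.1, -(3 * p.2.1 + 1), -(p.2.1 + p.2.2) - 1))
    (fun p => (p.1, (-p.2.1) / 3, -1 - p.2.2 - (-p.2.1) / 3)) ?_ ?_ ?_ ?_ ?_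
  · rintro ⟨a, b, c⟩ _; simp
  · simp
  · rintro ⟨a, b, c⟩ _; ext <;> simp <;> omega
  · rintro ⟨a, b, c⟩ h; simp at h; ext <;> simp; omega
  · rintro ⟨a, b, c⟩ _
    simp only [wD]
    push_cast
    have h1 := two_tri (-(3 * b + 1))
    have h2 := two_tri (-(b + c) - 1)
    have h3 := two_pent c
    nlinarith

theorem L123 : (2 * psi 2) * (X ^ 2 * ((2 * psi 21) * phi 3) + 2 * (fB 1 * fA 7)) = GS Set.univ wD := by
  have s1 := GS_split adm_wD (fun p => p.2.1 % 3 = 0)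
  have s2 := GS_split (S := {p : ℤ × ℤ × ℤ | ¬ p.2.1 % 3 = 0}) (adm_wD.mono (Set.subset_univ _))
      (fun p => p.2.1 % 3 = 1)
  have c1 : GS {i : ℤ × ℤ × ℤ | i ∈ Set.univ ∧ i.2.1 % 3 = 0} wD = GS {p : ℤ × ℤ × ℤ | p.2.1 % 3 = 0} wD :=
    GS_congr (fun p => by simp) (fun _ _ => rfl)
  have c2 : GS {i : ℤ × ℤ × ℤ | i ∈ Set.univ ∧ ¬ i.2.1 % 3 = 0} wD = GS {p : ℤ × ℤ × ℤ | ¬ p.2.1 % 3 = 0} wD :=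
    GS_congr (fun p => by simp) (fun _ _ => rfl)
  have c3 : GS {i : ℤ × ℤ × ℤ | i ∈ {p : ℤ × ℤ × ℤ | ¬ p.2.1 % 3 = 0} ∧ i.2.1 % 3 = 1} wD =
      GS {p : ℤ × ℤ × ℤ | p.2.1 % 3 = 1} wD :=
    GS_congr (fun p => by simp; omega) (fun _ _ => rfl)
  have c4 : GS {i : ℤ × ℤ × ℤ | i ∈ {p : ℤ × ℤ × ℤ | ¬ p.2.1 % 3 = 0} ∧ ¬ i.2.1 % 3 = 1} wD =
      GS {p : ℤ × ℤ × ℤ | p.2.1 % 3 = 2} wD :=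
    GS_congr (fun p => by simp; omega) (fun _ _ => rfl)
  rw [s1, c1, c2, s2, c3, c4, ← L1, ← L2, ← L3]
  ring

theorem D0 : GS {p : ℤ × ℤ × ℤ | (2 * p.1 + 1 + p.2.1) % 7 = 0} wD = (2 * psi 7) * (phi 7 * phi 7) := by
  rw [A_GS 7 (by norm_num)]
  symm
  refine GS_bij (fun p => (p.1 + 2 * p.2.2 + p.2.1, 3 * p.2.2 - 2 * p.1 - 2 * p.2.1 - 1, p.2.2 - p.1 - 1))
    (fun p => ((2 * p.1 + 1 + p.2.1) / 7 - 1 - p.2.2,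
      p.1 - ((2 * p.1 + 1 + p.2.1) / 7 - 1 - p.2.2) - 2 * ((2 * p.1 + 1 + p.2.1) / 7),
      (2 * p.1 + 1 + p.2.1) / 7)) ?_ ?_ ?_ ?_ ?_
  · rintro ⟨a, b, c⟩ _; simp; omega
  · simp
  · rintro ⟨a, b, c⟩ _; ext <;> simp <;> omega
  · rintro ⟨a, b, c⟩ h; simp at h; ext <;> simp <;> omega
  · rintro ⟨z, x, n⟩ _
    simp only [wD]
    push_cast
    have h1 := two_tri (z + 2 * n + x)
    have h2 := two_tri (3 * n - 2 * z - 2 * x - 1)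
    have h3 := two_tri (n - z - 1)
    have h4 := two_tri z
    nlinarith

theorem Dneg (k : ℤ) : GS {p : ℤ × ℤ × ℤ | (2 * p.1 + 1 + p.2.1) % 7 = k % 7} wD =
    GS {p : ℤ × ℤ × ℤ | (2 * p.1 + 1 + p.2.1) % 7 = (-k) % 7} wD := by
  refine GS_bij (fun p => (-1 - p.1, - p.2.1, -1 - p.2.2)) (fun p => (-1 - p.1, - p.2.1, -1 - p.2.2))
    ?_ ?_ ?_ ?_ ?_
  · rintro ⟨a, b, c⟩ h; simp at h ⊢; omega
  · rintro ⟨a, b, c⟩ h; simp at h ⊢; omega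
  · rintro ⟨a, b, c⟩ _; ext <;> simp
  · rintro ⟨a, b, c⟩ _; ext <;> simp
  · rintro ⟨a, b, c⟩ _
    simp only [wD]
    have h1 := two_tri a
    have h2 := two_tri b
    have h3 := two_tri c
    have h4 := two_tri (-1 - a)
    have h5 := two_tri (-b)
    have h6 := two_tri (-1 - c)
    nlinarith

def wS (p : ℤ × ℤ × ℤ) : ℤ :=
  (7 * p.1 ^ 2 + 2 * 1 * p.1 + (7 * p.2.1 ^ 2 + 2 * 2 * p.2.1 + (7 * p.2.2 ^ 2 + 2 * 3 * p.2.2))) + (2 : ℕ)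

theorem adm_wS : Adm Set.univ wS :=
  (((adm_ff 1 (by norm_num) (by norm_num)).prod ((adm_ff 2 (by norm_num) (by norm_num)).prod
    (adm_ff 3 (by norm_num) (by norm_num)))).addc 2).mono (by simp)

theorem S_GS : X ^ 2 * (ff 1 * (ff 2 * ff 3)) = GS Set.univ wS := by
  rw [ff, ff, ff, GS_mul (adm_ff 2 (by norm_num) (by norm_num)) (adm_ff 3 (by norm_num) (by norm_num)),
    GS_mul (adm_ff 1 (by norm_num) (by norm_num)) ((adm_ff 2 (by norm_num) (by norm_num)).prod
    (adm_ff 3 (by norm_num) (by norm_num))),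
    GS_X ((adm_ff 1 (by norm_num) (by norm_num)).prod ((adm_ff 2 (by norm_num) (by norm_num)).prod
    (adm_ff 3 (by norm_num) (by norm_num))))]
  exact GS_congr (by simp) (fun _ _ => rfl)

theorem S_par (a b c : ℤ) (h : wS (a, b, c) % 8 = 7) :
    (c % 2 = 0 ∧ a % 2 = 1 ∧ b % 2 = 0 ∧ (a - b - 3) % 4 = 0) ∨
    (c % 2 = 1 ∧ a % 2 = 1 ∧ b % 2 = 1 ∧ (a + c) % 4 = 0) ∨
    (c % 2 = 1 ∧ a % 2 = 0 ∧ b % 2 = 0 ∧ (b + c - 1) % 4 = 0) := by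
  have e : (7 * a + 1) ^ 2 + (7 * b + 2) ^ 2 + (7 * c + 3) ^ 2 = 7 * wS (a, b, c) := by
    simp only [wS]; push_cast; ring
  have h1 := sq8 (7 * a + 1)
  have h2 := sq8 (7 * b + 2)
  have h3 := sq8 (7 * c + 3)
  generalize (7 * a + 1) ^ 2 = x at *
  generalize (7 * b + 2) ^ 2 = y at *
  generalize (7 * c + 3) ^ 2 = z at *
  generalize wS (a, b, c) = w at *
  rcases h1 with h1 | h1 | h1 <;> rcases h2 with h2 | h2 | h2 <;> rcases h3 with h3 | h3 | h3 <;> omega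

theorem S5 : ex (GS {p : ℤ × ℤ × ℤ | p.2.2 % 2 = 0} wS) =
    GS {p : ℤ × ℤ × ℤ | (2 * p.1 + 1 + p.2.1) % 7 = 5} wD := by
  refine GS_ex (fun p => let g := (p.1 - p.2.1 - 3) / 4; let r := p.2.1 + g + 1
      let a := p.2.2 + 5 * g + 4 + r; let u := 7 * g + 5 - a; ((a - 1) / 2, u, (r + u - 1) / 2))
    (fun p => let a := 2 * p.1 + 1; let g := (a + p.2.1 - 5) / 7; let r := 2 * p.2.2 + 1 - p.2.1
      (3 * g + 2 + r, -g - 1 + r, a - 5 * g - 4 - r)) ?_ ?_ ?_ ?_ ?_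
  · rintro ⟨a, b, c⟩ h' h
    have := S_par a b c h
    simp at h' ⊢; omega
  · rintro ⟨a, b, c⟩ h; simp at h ⊢; omega
  · rintro ⟨a, b, c⟩ h' h
    have := S_par a b c h
    simp at h'; ext <;> simp <;> omega
  · rintro ⟨a, b, c⟩ h; simp at h; ext <;> simp <;> omega
  · rintro ⟨a, u, e⟩ h
    simp at h
    obtain ⟨g, rfl⟩ : ∃ g, u = 7 * g + 5 - (2 * a + 1) := ⟨(2 * a + 1 + u - 5) / 7, by omega⟩
    have e1 : (2 * a + 1 + (7 * g + 5 - (2 * a + 1)) - 5) / 7 = g := by omega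
    simp only [e1]
    have := wD_norm a (7 * g + 5 - (2 * a + 1)) e
    simp only [wS]
    push_cast
    nlinarith

theorem S1 : ex (GS {p : ℤ × ℤ × ℤ | p.2.2 % 2 = 1 ∧ p.2.1 % 2 = 1} wS) =
    GS {p : ℤ × ℤ × ℤ | (2 * p.1 + 1 + p.2.1) % 7 = 1} wD := by
  refine GS_ex (fun p => let g := (p.1 + p.2.2) / 4; let r := g - p.1
      let a := p.2.1 + 5 * g + 1 + r; let u := 7 * g + 1 - a; ((a - 1) / 2, u, (r + u - 1) / 2))
    (fun p => let a := 2 * p.1 + 1; let g := (a + p.2.1 - 1) / 7; let r := 2 * p.2.2 + 1 - p.2.1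
      (g - r, a - 5 * g - 1 - r, 3 * g + r)) ?_ ?_ ?_ ?_ ?_
  · rintro ⟨a, b, c⟩ h' h
    have := S_par a b c h
    simp at h' ⊢; omega
  · rintro ⟨a, b, c⟩ h; simp at h ⊢; omega
  · rintro ⟨a, b, c⟩ h' h
    have := S_par a b c h
    simp at h'; ext <;> simp <;> omega
  · rintro ⟨a, b, c⟩ h; simp at h; ext <;> simp <;> omega
  · rintro ⟨a, u, e⟩ h
    simp at h
    obtain ⟨g, rfl⟩ : ∃ g, u = 7 * g + 1 - (2 * a + 1) := ⟨(2 * a + 1 + u - 1) / 7, by omega⟩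
    have e1 : (2 * a + 1 + (7 * g + 1 - (2 * a + 1)) - 1) / 7 = g := by omega
    simp only [e1]
    have := wD_norm a (7 * g + 1 - (2 * a + 1)) e
    simp only [wS]
    push_cast
    nlinarith

theorem S3 : ex (GS {p : ℤ × ℤ × ℤ | p.2.2 % 2 = 1 ∧ p.2.1 % 2 = 0} wS) =
    GS {p : ℤ × ℤ × ℤ | (2 * p.1 + 1 + p.2.1) % 7 = 3} wD := by
  refine GS_ex (fun p => let g := (p.2.1 + p.2.2 - 1) / 4; let r := g - p.2.2
      let a := 5 * g + 2 + r - p.1; let u := 7 * g + 3 - a; ((a - 1) / 2, u, (r + u - 1) / 2))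
    (fun p => let a := 2 * p.1 + 1; let g := (a + p.2.1 - 3) / 7; let r := 2 * p.2.2 + 1 - p.2.1
      (-a + 5 * g + 2 + r, 3 * g + 1 + r, g - r)) ?_ ?_ ?_ ?_ ?_
  · rintro ⟨a, b, c⟩ h' h
    have := S_par a b c h
    simp at h' ⊢; omega
  · rintro ⟨a, b, c⟩ h; simp at h ⊢; omega
  · rintro ⟨a, b, c⟩ h' h
    have := S_par a b c h
    simp at h'; ext <;> simp <;> omega
  · rintro ⟨a, b, c⟩ h; simp at h; ext <;> simp <;> omega
  · rintro ⟨a, u, e⟩ h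
    simp at h
    obtain ⟨g, rfl⟩ : ∃ g, u = 7 * g + 3 - (2 * a + 1) := ⟨(2 * a + 1 + u - 3) / 7, by omega⟩
    have e1 : (2 * a + 1 + (7 * g + 3 - (2 * a + 1)) - 3) / 7 = g := by omega
    simp only [e1]
    have := wD_norm a (7 * g + 3 - (2 * a + 1)) e
    simp only [wS]
    push_cast
    nlinarith

def Dk (k : ℤ) : Set (ℤ × ℤ × ℤ) := {p | (2 * p.1 + 1 + p.2.1) % 7 = k}

theorem Dsum (j : ℕ) (hj : j ≤ 7) : GS {p : ℤ × ℤ × ℤ | (2 * p.1 + 1 + p.2.1) % 7 < j} wD =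
    ∑ k ∈ Finset.range j, GS (Dk k) wD := by
  induction j with
  | zero =>
    ext n
    have : {i : ℤ × ℤ × ℤ | i ∈ {p : ℤ × ℤ × ℤ | (2 * p.1 + 1 + p.2.1) % 7 < ((0 : ℕ) : ℤ)} ∧ wD i = (n : ℤ)} = ∅ := by
      ext p
      simp
      omega
    rw [GS, PowerSeries.coeff_mk, this]
    simp
  | succ j ih =>
    rw [Finset.sum_range_succ, ← ih (by omega), GS_split (adm_wD.mono (Set.subset_univ _))
      (fun p => (2 * p.1 + 1 + p.2.1) % 7 < (j : ℤ))]
    congr 1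
    · exact GS_congr (fun p => by simp; omega) (fun _ _ => rfl)
    · exact GS_congr (fun p => by simp [Dk]; omega) (fun _ _ => rfl)

theorem lattice : (2 * psi 2) * (X ^ 2 * ((2 * psi 21) * phi 3) + 2 * (fB 1 * fA 7)) =
    (2 * psi 7) * (phi 7 * phi 7) + 2 * ex (X ^ 2 * (ff 1 * (ff 2 * ff 3))) := by
  have s0 : GS Set.univ wD = GS {p : ℤ × ℤ × ℤ | (2 * p.1 + 1 + p.2.1) % 7 < (7 : ℕ)} wD :=
    GS_congr (fun p => by simp; omega) (fun _ _ => rfl)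
  have s1 := GS_split adm_wS (fun p => p.2.2 % 2 = 0)
  have s2 := GS_split (S := {p : ℤ × ℤ × ℤ | ¬ p.2.2 % 2 = 0}) (adm_wS.mono (Set.subset_univ _))
      (fun p => p.2.1 % 2 = 1)
  have c1 : GS {i : ℤ × ℤ × ℤ | i ∈ Set.univ ∧ i.2.2 % 2 = 0} wS = GS {p : ℤ × ℤ × ℤ | p.2.2 % 2 = 0} wS :=
    GS_congr (fun p => by simp) (fun _ _ => rfl)
  have c2 : GS {i : ℤ × ℤ × ℤ | i ∈ Set.univ ∧ ¬ i.2.2 % 2 = 0} wS = GS {p : ℤ × ℤ × ℤ | ¬ p.2.2 % 2 = 0} wS :=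
    GS_congr (fun p => by simp) (fun _ _ => rfl)
  have c3 : GS {i : ℤ × ℤ × ℤ | i ∈ {p : ℤ × ℤ × ℤ | ¬ p.2.2 % 2 = 0} ∧ i.2.1 % 2 = 1} wS =
      GS {p : ℤ × ℤ × ℤ | p.2.2 % 2 = 1 ∧ p.2.1 % 2 = 1} wS :=
    GS_congr (fun p => by simp) (fun _ _ => rfl)
  have c4 : GS {i : ℤ × ℤ × ℤ | i ∈ {p : ℤ × ℤ × ℤ | ¬ p.2.2 % 2 = 0} ∧ ¬ i.2.1 % 2 = 1} wS =
      GS {p : ℤ × ℤ × ℤ | p.2.2 % 2 = 1 ∧ p.2.1 % 2 = 0} wS :=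
    GS_congr (fun p => by simp) (fun _ _ => rfl)
  have n1 := Dneg 1
  have n3 := Dneg 3
  have n5 := Dneg 5
  norm_num at n1 n3 n5
  rw [S_GS, s1, c1, c2, s2, c3, c4, map_add, map_add, S5, S1, S3, L123, s0, Dsum 7 le_rfl]
  simp only [Finset.sum_range_succ, Finset.sum_range_zero, Dk]
  push_cast
  rw [D0, ← n1, ← n3, ← n5]
  ring

theorem final (star : 8 * X ^ 2 * (ff 1 * (ff 2 * ff 3)) =
    phi 7 * (phi 7 * phi 7) - phi 7 * (phi 1 * phi 1) + 4 * X * psi 1 * psi 7 * phi 1) :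
    7 * phi 7 ^ 2 * psi 7 =
      8 * X ^ 2 * psi 2 * psi 21 * phi 3 + 8 * psi 2 * fB 1 * fA 7
        - 4 * X * psi 14 * psi 1 * phi 1 - psi 7 * phi 1 ^ 2 := by
  have e8 : ∀ f : PowerSeries ℤ, 8 * ex f = ex (8 * f) := by
    intro f
    have : (8 : PowerSeries ℤ) * f = (8 : ℕ) • f := by rw [nsmul_eq_mul]; norm_num
    rw [this, map_nsmul, nsmul_eq_mul]; norm_num
  have e1 : 8 * ex (X ^ 2 * (ff 1 * (ff 2 * ff 3))) = 3 * ((2 * psi 7) * (phi 7 * phi 7))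
      + (2 * psi 7) * (phi 1 * phi 1) + 2 * (4 * X * psi 14 * psi 1 * phi 1) := by
    have : 8 * (X ^ 2 * (ff 1 * (ff 2 * ff 3))) = phi 7 * (phi 7 * phi 7) + phi 7 * (phi 1 * phi 1) 
       - (phi 1 * PowerSeries.expand 2 two_ne_zero (ng (phi 1 * phi 7)) + 
       phi 1 * PowerSeries.expand 2 two_ne_zero (ng (phi 1 * phi 7))) := by
      linear_combination star + (- 2 * phi 1) * deg7
    rw [e8, this, map_sub, map_add, map_add, exA, exB, exC]
    ring
  have l := lattice
  have h2 : (2 : PowerSeries ℤ) ≠ 0 := ps_ne 2 (by rw [map_ofNat]; norm_num)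
  refine mul_left_cancel₀ h2 ?_
  linear_combination (-4) * l - e1


noncomputable def DD (f : PowerSeries ℤ) : PowerSeries ℤ := X * PowerSeries.derivative ℤ f

theorem coeff_DD (f : PowerSeries ℤ) (n : ℕ) : coeff n (DD f) = n * coeff n f := by
  rw [DD]
  cases n with
  | zero => simp
  | succ n =>
    rw [PowerSeries.coeff_succ_X_mul, PowerSeries.coeff_derivative]
    push_cast; ring

theorem DD_add (f g : PowerSeries ℤ) : DD (f + g) = DD f + DD g := by
  simp [DD, mul_add]

theorem DD_mul (f g : PowerSeries ℤ) : DD (f * g) = DD f * g + f * DD g := by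
  simp only [DD, Derivation.leibniz, smul_eq_mul]; ring

theorem DD_X : DD X = X := by
  simp [DD]

theorem DD_num (c : ℤ) : DD (PowerSeries.C c) = 0 := by
  simp [DD]

theorem DD_expand (p : ℕ) (hp : p ≠ 0) (f : PowerSeries ℤ) :
    DD (PowerSeries.expand p hp f) = p * PowerSeries.expand p hp (DD f) := by
  have : ((p : ℕ) : PowerSeries ℤ) = PowerSeries.C (p : ℤ) := by simp
  ext n
  rw [this, PowerSeries.coeff_C_mul, coeff_DD, coeff_expand', coeff_expand']
  split_ifs with h
  · obtain ⟨c, rfl⟩ := h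
    rw [Nat.mul_div_cancel_left _ (Nat.pos_of_ne_zero hp), coeff_DD]
    push_cast; ring
  · simp

theorem zero_of_expand (a b Z : PowerSeries ℤ) (ha : PowerSeries.constantCoeff a = 1)
    (hZ : PowerSeries.constantCoeff Z = 0) (h : a * Z = b * PowerSeries.expand 2 two_ne_zero Z) :
    Z = 0 := by
  have hu : IsUnit a := by rw [PowerSeries.isUnit_iff_constantCoeff, ha]; exact isUnit_one
  have key : ∀ n : ℕ, (X : PowerSeries ℤ) ^ (n + 1) ∣ Z := by
    intro n
    induction n with
    | zero => simpa [PowerSeries.X_dvd_iff] using hZ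
    | succ n ih =>
      rw [← hu.dvd_mul_left, h]
      refine Dvd.dvd.mul_left ?_ _
      obtain ⟨Y, hY⟩ := ih
      rw [hY, map_mul, map_pow, PowerSeries.expand_X, ← pow_mul]
      refine Dvd.dvd.mul_right (pow_dvd_pow _ (by omega)) _
  ext n
  have := key n
  rw [PowerSeries.X_pow_dvd_iff] at this
  simpa using this n (by omega)

theorem eq_of_sq (a b : PowerSeries ℤ) (h : a ^ 2 = b ^ 2)
    (h0 : PowerSeries.constantCoeff (a + b) ≠ 0) : a = b := by
  have h1 : (a + b) * (a - b) = 0 := by linear_combination h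
  rcases mul_eq_zero.1 h1 with h2 | h2
  · rw [h2] at h0; simp at h0
  · exact sub_eq_zero.1 h2

theorem cc_phi (k : ℕ) (hk : 0 < k) : PowerSeries.constantCoeff (phi k) = 1 := by
  rw [← PowerSeries.coeff_zero_eq_constantCoeff_apply, phi, PowerSeries.coeff_mk]
  have : {m : ℤ | ((0 : ℕ) : ℤ) = k * m ^ 2} = {0} := by
    ext m
    simp; omega
  rw [this]; simp

theorem cc_psi (k : ℕ) (hk : 0 < k) : PowerSeries.constantCoeff (psi k) = 1 := by
  rw [← PowerSeries.coeff_zero_eq_constantCoeff_apply, psi, PowerSeries.coeff_mk]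
  have : {m : ℤ | 0 ≤ m ∧ ((0 : ℕ) : ℤ) = k * (m * (m + 1) / 2)} = {0} := by
    ext m
    simp only [Set.mem_ofPred_eq, Set.mem_singleton_iff]
    constructor
    · rintro ⟨h1, h2⟩
      have h3 : tri m = 0 := by
        have : (k : ℤ) * tri m = 0 := by rw [tri, ← h2]; simp
        rcases mul_eq_zero.1 this with h | h
        · omega
        · exact h
      have := two_tri m
      rw [h3] at this
      nlinarith
    · rintro rfl; simp
  rw [this]; simp

theorem cc_ng (f : PowerSeries ℤ) : PowerSeries.constantCoeff (ng f) = PowerSeries.constantCoeff f := by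
  rw [← PowerSeries.coeff_zero_eq_constantCoeff_apply, coeff_ng]; simp

theorem ng_X : ng X = -X := by
  ext n
  rw [coeff_ng, map_neg, PowerSeries.coeff_X]
  split_ifs with h
  · simp [h]
  · simp

theorem ng_expand_odd (p : ℕ) (hp : p ≠ 0) (ho : Odd p) (f : PowerSeries ℤ) :
    ng (PowerSeries.expand p hp f) = PowerSeries.expand p hp (ng f) := by
  ext n
  rw [coeff_ng, coeff_expand', coeff_expand']
  split_ifs with h
  · obtain ⟨c, rfl⟩ := h
    rw [Nat.mul_div_cancel_left _ (Nat.pos_of_ne_zero hp), coeff_ng, pow_mul, ho.neg_one_pow]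
  · simp

theorem ng_expand_even (p : ℕ) (hp : p ≠ 0) (ho : Even p) (f : PowerSeries ℤ) :
    ng (PowerSeries.expand p hp f) = PowerSeries.expand p hp f := by
  ext n
  rw [coeff_ng, coeff_expand']
  split_ifs with h
  · obtain ⟨c, rfl⟩ := h
    rw [Nat.mul_div_cancel_left _ (Nat.pos_of_ne_zero hp), pow_mul, ho.neg_one_pow]
    simp
  · simp

theorem exp_num (p : ℕ) (hp : p ≠ 0) (n : ℕ) [n.AtLeastTwo] :
    PowerSeries.expand p hp (OfNat.ofNat n : PowerSeries ℤ) = OfNat.ofNat n :=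
  map_ofNat (PowerSeries.expand p hp) n

theorem b3' : psi 2 ^ 2 = phi 2 * psi 4 := by
  have := congrArg (PowerSeries.expand 2 two_ne_zero) b3
  rw [map_pow, map_mul, psi_expand, phi_expand, psi_expand] at this
  simpa using this

noncomputable abbrev mm : PowerSeries ℤ := ng (phi 1)
noncomputable abbrev uu : PowerSeries ℤ := PowerSeries.expand 2 two_ne_zero mm

theorem b2m : mm ^ 2 = phi 2 ^ 2 - 4 * X * psi 4 ^ 2 := by
  have := congrArg ng b2
  have h1 : ng (phi 2) = phi 2 := by
    have := phi_expand 2 two_ne_zero 1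
    rw [← this]; exact ng_expand_even _ _ (by decide) _
  have h2 : ng (psi 4) = psi 4 := by
    have := psi_expand 2 two_ne_zero 2
    rw [← this]; exact ng_expand_even _ _ (by decide) _
  rw [map_add, map_mul, map_mul, map_pow, map_pow, map_pow, ng_X, h1, h2, map_ofNat] at this
  linear_combination this

theorem quart : phi 1 ^ 4 = mm ^ 4 + 16 * X * psi 2 ^ 4 := by
  have h1 := b2
  have h2 := b2m
  have h3 := b3'
  linear_combination (phi 1 ^ 2 + phi 2 ^ 2 + 4 * X * psi 4 ^ 2) * h1
    - (mm ^ 2 + phi 2 ^ 2 - 4 * X * psi 4 ^ 2) * h2 - 16 * X * (psi 2 ^ 2 + phi 2 * psi 4) * h3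

theorem pm_eq : phi 1 * mm = uu ^ 2 := by
  apply eq_of_sq
  · have h := congrArg (PowerSeries.expand 2 two_ne_zero) quart
    rw [map_add, map_mul, map_mul, map_pow, map_pow, map_pow, PowerSeries.expand_X, exp_num,
      psi_expand, phi_expand] at h
    norm_num at h
    linear_combination h + mm ^ 2 * b2 + (phi 2 ^ 2 + 4 * X * psi 4 ^ 2) * b2m
  · rw [map_add, map_mul, map_pow, PowerSeries.constantCoeff_expand, cc_ng, cc_phi 1 one_pos]
    norm_num

theorem cc_DD (f : PowerSeries ℤ) : PowerSeries.constantCoeff (DD f) = 0 := by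
  simp [DD]

theorem dlog : phi 1 * psi 2 + 4 * (DD (psi 2) * phi 1 - psi 2 * DD (phi 1)) =
    phi 1 * psi 2 * mm ^ 4 := by
  set W := phi 1 * psi 2 + 4 * (DD (psi 2) * phi 1 - psi 2 * DD (phi 1)) with hW
  have hW2 : PowerSeries.expand 2 two_ne_zero W = phi 2 * psi 4 +
      2 * (DD (psi 4) * phi 2 - psi 4 * DD (phi 2)) := by
    have e1 := DD_expand 2 two_ne_zero (psi 2)
    have e2 := DD_expand 2 two_ne_zero (phi 1)
    rw [psi_expand] at e1
    rw [phi_expand] at e2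
    norm_num at e1 e2
    rw [hW, map_add, map_mul, map_mul, map_sub, map_mul, map_mul, exp_num, psi_expand, phi_expand, e1, e2]
    norm_num
    ring
  have k3 : 2 * psi 2 * DD (psi 2) = DD (phi 2) * psi 4 + phi 2 * DD (psi 4) := by
    have := congrArg DD b3'
    rw [pow_two, DD_mul, DD_mul] at this
    linear_combination this
  have k2 : 2 * phi 1 * DD (phi 1) = 2 * phi 2 * DD (phi 2) + 4 * X * psi 4 ^ 2
      + 8 * X * psi 4 * DD (psi 4) := by
    have := congrArg DD b2
    have h4 : (4 : PowerSeries ℤ) = PowerSeries.C 4 := by simp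
    rw [pow_two, DD_mul, pow_two, DD_add, DD_mul, pow_two, DD_mul, DD_mul, DD_mul, DD_X, h4, DD_num, ← h4] at this
    linear_combination this
  have hWe : (phi 1 * psi 2) * W = mm ^ 2 * PowerSeries.expand 2 two_ne_zero W := by
    rw [hW2, hW]
    have h1 := b2
    have h2 := b2m
    have h3 := b3'
    linear_combination (exp := 1) 2 * phi 1 ^ 2 * k3 - 2 * psi 2 ^ 2 * k2 
      + (psi 2 ^ 2 + 2 * (DD (phi 2) * psi 4 + phi 2 * DD (psi 4))) * h1
      - (phi 2 * psi 4 + 2 * (DD (psi 4) * phi 2 - psi 4 * DD (phi 2))) * h2 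
      + (phi 2 ^ 2 + 4 * X * psi 4 ^ 2 - 4 * phi 2 * DD (phi 2) - 8 * X * psi 4 ^ 2
      - 16 * X * psi 4 * DD (psi 4)) * h3
  have hK : (phi 1 * psi 2) * (phi 1 * psi 2 * mm ^ 4) = 
      mm ^ 2 * PowerSeries.expand 2 two_ne_zero (phi 1 * psi 2 * mm ^ 4) := by
    rw [map_mul, map_mul, phi_expand, psi_expand, map_pow]
    norm_num
    have h1 := pm_eq
    have h3 := b3'
    linear_combination phi 1 ^ 2 * mm ^ 4 * h3 + mm ^ 2 * phi 2 * psi 4 * (phi 1 * mm + uu ^ 2) * h1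
  have hz := zero_of_expand (phi 1 * psi 2) (mm ^ 2) (W - phi 1 * psi 2 * mm ^ 4) ?_ ?_ ?_
  · exact sub_eq_zero.1 hz
  · rw [map_mul, cc_phi 1 one_pos, cc_psi 2 two_pos]; norm_num
  · rw [hW]
    simp only [map_sub, map_add, map_mul, map_pow, cc_phi 1 one_pos, cc_psi 2 two_pos, cc_DD, cc_ng]
    norm_num
  · rw [map_sub]
    linear_combination hWe - hK

theorem ex_log (f : PowerSeries ℤ) (h : PowerSeries.constantCoeff f = 1) : ∃ l, DD f = l * f := by
  have hu : IsUnit f := by rw [PowerSeries.isUnit_iff_constantCoeff, h]; exact isUnit_one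
  obtain ⟨g, hg⟩ := hu.exists_left_inv
  exact ⟨DD f * g, by rw [mul_assoc, hg, mul_one]⟩

theorem exp7_comm (f : PowerSeries ℤ) : PowerSeries.expand 2 two_ne_zero (PowerSeries.expand 7 (by norm_num) f) =
    PowerSeries.expand 7 (by norm_num) (PowerSeries.expand 2 two_ne_zero f) := by
  rw [← PowerSeries.expand_mul, ← PowerSeries.expand_mul]

noncomputable abbrev m7 : PowerSeries ℤ := PowerSeries.expand 7 (by norm_num) mm
noncomputable abbrev u7 : PowerSeries ℤ := PowerSeries.expand 7 (by norm_num) uu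

theorem deg7' : phi 1 * phi 7 = uu * u7 + 2 * X * psi 1 * psi 7 := by
  have h := deg7
  have h7 : phi 7 = PowerSeries.expand 7 (by norm_num) (phi 1) := (phi_expand 7 (by norm_num) 1).symm
  have q : PowerSeries.expand 2 two_ne_zero (ng (phi 7)) = u7 := by
    rw [h7, ng_expand_odd _ _ (by decide), exp7_comm]
  rw [map_mul ng, map_mul, q] at h
  exact h

theorem two_ne : (2 : PowerSeries ℤ) ≠ 0 := ps_ne 2 (by rw [map_ofNat]; norm_num)

theorem relII : (2 * X * psi 1 * psi 7) * (mm ^ 4 + 7 * m7 ^ 4) =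
    16 * (uu * u7) * (X * psi 2 ^ 4 + 7 * X ^ 7 * psi 14 ^ 4) := by
  have np := ps_ne (phi 1) (by rw [cc_phi 1 one_pos]; norm_num)
  have ns := ps_ne (psi 1) (by rw [cc_psi 1 one_pos]; norm_num)
  have ne := ps_ne (psi 2) (by rw [cc_psi 2 two_pos]; norm_num)
  have nm := ps_ne mm (by rw [cc_ng, cc_phi 1 one_pos]; norm_num)
  have cu : PowerSeries.constantCoeff uu = 1 := by
    rw [PowerSeries.constantCoeff_expand, cc_ng, cc_phi 1 one_pos]
  have nu := ps_ne uu (by rw [cu]; norm_num)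
  obtain ⟨lp, hlp⟩ := ex_log (phi 1) (cc_phi 1 one_pos)
  obtain ⟨ls, hls⟩ := ex_log (psi 1) (cc_psi 1 one_pos)
  obtain ⟨le, hle⟩ := ex_log (psi 2) (cc_psi 2 two_pos)
  obtain ⟨lm, hlm⟩ := ex_log mm (by rw [cc_ng, cc_phi 1 one_pos])
  obtain ⟨lu, hlu⟩ := ex_log uu cu
  have r1 : 1 + 4 * le - 4 * lp = mm ^ 4 := by
    have h := dlog
    rw [hlp, hle] at h
    refine mul_left_cancel₀ (mul_ne_zero np ne) ?_
    linear_combination h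
  have r2 : 2 * ls = lp + le := by
    have h := congrArg DD b3
    rw [pow_two, DD_mul, DD_mul, hls, hlp, hle] at h
    refine mul_left_cancel₀ (mul_ne_zero np ne) ?_
    linear_combination h - 2 * ls * b3
  have r3 : 2 * lu = lp + lm := by
    have h := congrArg DD pm_eq
    rw [pow_two, DD_mul, DD_mul, hlu, hlp, hlm] at h
    refine mul_left_cancel₀ (pow_ne_zero 2 nu) ?_
    linear_combination -h + (lp + lm) * pm_eq
  have r4 : lm - lp = - 4 * X * psi 2 ^ 4 := by
    have h := congrArg DD quart
    have h16 : (16 : PowerSeries ℤ) = PowerSeries.C 16 := by simp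
    have pw : ∀ f l : PowerSeries ℤ, DD f = l * f → DD (f ^ 4) = 4 * l * f ^ 4 := by
      intro f l hf
      rw [show f ^ 4 = (f * f) * (f * f) by ring, DD_mul, DD_mul, hf]; ring
    rw [DD_add, DD_mul, DD_mul, DD_X, h16, DD_num, ← h16, pw _ _ hlp, pw _ _ hlm, pw _ _ hle] at h
    have n4 : (4 : PowerSeries ℤ) ≠ 0 := ps_ne 4 (by rw [map_ofNat]; norm_num)
    refine mul_left_cancel₀ (mul_ne_zero n4 (pow_ne_zero 4 nm)) ?_
    linear_combination -h + 4 * lp * quart - 16 * X * psi 2 ^ 4 * r1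
  have k : ∀ f l g : PowerSeries ℤ, DD f = l * f → PowerSeries.expand 7 (by norm_num) f = g →
      DD g = 7 * PowerSeries.expand 7 (by norm_num) l * g := by
    rintro f l g hf rfl
    rw [DD_expand, hf, map_mul]; push_cast; ring
  have kp := k (phi 1) lp (phi 7) hlp (phi_expand 7 (by norm_num) 1)
  have ks := k (psi 1) ls (psi 7) hls (psi_expand 7 (by norm_num) 1)
  have ku := k uu lu u7 hlu rfl
  have h := congrArg DD deg7'
  have h2 : (2 : PowerSeries ℤ) = PowerSeries.C 2 := by simp
  rw [DD_add, DD_mul, DD_mul, DD_mul, DD_mul, DD_mul, DD_X, h2, DD_num, ← h2, hlp, hls, hlu, kp, ks, ku] at h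
  have t1 := congrArg (PowerSeries.expand 7 (by norm_num : 7 ≠ 0)) r1
  have t2 := congrArg (PowerSeries.expand 7 (by norm_num : 7 ≠ 0)) r2
  have t3 := congrArg (PowerSeries.expand 7 (by norm_num : 7 ≠ 0)) r3
  have t4 := congrArg (PowerSeries.expand 7 (by norm_num : 7 ≠ 0)) r4
  have n2 := exp_num 7 (by norm_num) 2
  have n4 := exp_num 7 (by norm_num) 4
  simp only [map_add, map_sub, map_mul, map_neg, map_pow, n2, n4, map_one, PowerSeries.expand_X, psi_expand] at t1 t2 t3 t4
  norm_num at t1 t2 t3 t4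
  generalize PowerSeries.expand 7 (by norm_num : 7 ≠ 0) lp = lp7 at *
  generalize PowerSeries.expand 7 (by norm_num : 7 ≠ 0) ls = ls7 at *
  generalize PowerSeries.expand 7 (by norm_num : 7 ≠ 0) lu = lu7 at *
  generalize PowerSeries.expand 7 (by norm_num : 7 ≠ 0) lm = lm7 at *
  generalize PowerSeries.expand 7 (by norm_num : 7 ≠ 0) le = le7 at *
  linear_combination (-8) * h + 8 * (lp + 7 * lp7) * deg7' 
    - (2 * X * psi 1 * psi 7) * (r1 + 7 * t1 + 4 * r2 + 28 * t2)
    - 4 * (uu * u7) * (r3 + 7 * t3 + r4 + 7 * t4)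


section JTP
variable {R : Type} [CommRing R]

def gb (Q : R) : ℕ → ℕ → R
  | _, 0 => 1
  | 0, _ + 1 => 0
  | N + 1, k + 1 => gb Q N k + Q ^ (k + 1) * gb Q N (k + 1)

theorem gb_zero (Q : R) (N : ℕ) : gb Q N 0 = 1 := by cases N <;> rfl

theorem gb_succ (Q : R) (N k : ℕ) :
    gb Q (N + 1) (k + 1) = gb Q N k + Q ^ (k + 1) * gb Q N (k + 1) := rfl

theorem gb_lt (Q : R) (N : ℕ) : ∀ k, N < k → gb Q N k = 0 := by
  induction N with
  | zero =>
    intro k hk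
    obtain ⟨j, rfl⟩ : ∃ j, k = j + 1 := ⟨k - 1, by omega⟩
    rfl
  | succ N ih =>
    intro k hk
    obtain ⟨j, rfl⟩ : ∃ j, k = j + 1 := ⟨k - 1, by omega⟩
    rw [gb_succ, ih j (by omega), ih (j + 1) (by omega)]; ring

def qp (Q : R) (n : ℕ) : R := ∏ j ∈ Finset.range n, (1 - Q ^ (j + 1))

theorem qp_succ (Q : R) (n : ℕ) : qp Q (n + 1) = qp Q n * (1 - Q ^ (n + 1)) :=
  Finset.prod_range_succ _ _

theorem gb_qp (Q : R) (N : ℕ) : ∀ i j, i + j = N → gb Q N i * (qp Q i * qp Q j) = qp Q N := by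
  induction N with
  | zero =>
    intro i j h
    obtain rfl : i = 0 := by omega
    obtain rfl : j = 0 := by omega
    simp [gb_zero, qp]
  | succ N ih =>
    intro i j h
    cases i with
    | zero =>
      obtain rfl : j = N + 1 := by omega
      simp [gb_zero, qp]
    | succ i =>
      rw [gb_succ]
      cases j with
      | zero =>
        obtain rfl : i = N := by omega
        rw [gb_lt Q i (i + 1) (by omega)]
        have := ih i 0 (by omega)
        rw [qp_succ]
        linear_combination (1 - Q ^ (i + 1)) * this
      | succ j =>
        have h1 := ih i (j + 1) (by omega)
        have h2 := ih (i + 1) j (by omega)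
        have e : Q ^ (N + 1) = Q ^ (i + 1) * Q ^ (j + 1) := by rw [← pow_add]; congr 1; omega
        rw [qp_succ Q j] at h1 ⊢
        rw [qp_succ Q i] at h2 ⊢
        rw [qp_succ Q N, e]
        linear_combination (1 - Q ^ (i + 1)) * h1 + Q ^ (i + 1) * (1 - Q ^ (j + 1)) * h2

theorem qbin (Q : R) (N : ℕ) : ∀ x y : R, ∏ j ∈ Finset.range N, (y + x * Q ^ j) =
    ∑ p ∈ Finset.HasAntidiagonal.antidiagonal N, gb Q N p.1 * Q ^ (p.1.choose 2) * x ^ p.1 * y ^ p.2 := by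
  induction N with
  | zero => intro x y; simp [gb_zero]
  | succ N ih =>
    intro x y
    rw [Finset.prod_range_succ']
    have e : ∀ j, y + x * Q ^ (j + 1) = y + (x * Q) * Q ^ j := fun j => by ring
    simp only [e]
    rw [ih (x * Q) y, Finset.Nat.sum_antidiagonal_succ]
    have e2 : ∑ p ∈ Finset.HasAntidiagonal.antidiagonal (N + 1),
        gb Q N p.1 * Q ^ (p.1.choose 2 + p.1) * x ^ p.1 * y ^ p.2 =
        y * ∑ p ∈ Finset.HasAntidiagonal.antidiagonal N,
          gb Q N p.1 * Q ^ (p.1.choose 2) * (x * Q) ^ p.1 * y ^ p.2 := by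
      rw [Finset.Nat.sum_antidiagonal_succ', Finset.mul_sum]
      simp only
      rw [gb_lt Q N (N + 1) (by omega)]
      simp only [zero_mul, zero_add]
      refine Finset.sum_congr rfl fun p _ => ?_
      rw [mul_pow]; ring
    rw [Finset.Nat.sum_antidiagonal_succ] at e2
    simp only [gb_zero, gb_succ, Nat.choose_zero_succ, pow_zero, add_zero, mul_one, one_mul] at e2 ⊢
    rw [mul_add, mul_comm _ y, ← e2, Finset.sum_mul]
    rw [add_assoc, ← Finset.sum_add_distrib]
    congr 1
    refine Finset.sum_congr rfl fun p _ => ?_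
    have : (p.1 + 1).choose 2 = p.1.choose 2 + p.1 := by
      rw [Nat.choose_succ_succ' p.1 1]; simp; ring
    rw [this, mul_pow]; ring

end JTP

theorem finJTP (A B n : ℕ) (w : ℤ → ℤ) (h0 : ∀ m, 0 ≤ w m)
    (hw : ∀ m, 2 * w m = A * (m * (m + 1)) + B * (m * (m - 1))) :
    ∏ j ∈ Finset.range n, ((1 + X ^ A * (X ^ (A + B)) ^ j) * (1 + X ^ B * (X ^ (A + B)) ^ j)) =
    ∑ p ∈ Finset.HasAntidiagonal.antidiagonal (2 * n),
      gb ((X : PowerSeries ℤ) ^ (A + B)) (2 * n) p.1 * X ^ (w ((p.1 : ℤ) - n)).toNat := by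
  set Q : PowerSeries ℤ := X ^ (A + B) with hQ
  have key := qbin Q (2 * n) (X ^ A) (Q ^ n)
  have hx : (X ^ (A * n + (A + B) * (n.choose 2 + n * n)) : PowerSeries ℤ) ≠ 0 := 
    pow_ne_zero _ PowerSeries.X_ne_zero
  refine mul_left_cancel₀ hx ?_
  have c2 : ∀ k : ℕ, 2 * (k.choose 2 : ℤ) = k * (k - 1) := by
    intro k
    induction k with
    | zero => simp
    | succ k ih => 
      rw [Nat.choose_succ_succ' k 1]; push_cast; simp; linarith
  rw [Finset.mul_sum]
  have l : X ^ (A * n + (A + B) * (n.choose 2 + n * n)) *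
      ∏ j ∈ Finset.range n, ((1 + X ^ A * Q ^ j) * (1 + X ^ B * Q ^ j)) =
      ∏ j ∈ Finset.range (2 * n), (Q ^ n + X ^ A * Q ^ j) := by
    rw [two_mul, Finset.prod_range_add, Finset.prod_mul_distrib]
    have e1 : ∏ j ∈ Finset.range n, (Q ^ n + X ^ A * Q ^ (n + j)) = 
        Q ^ (n * n) * ∏ j ∈ Finset.range n, (1 + X ^ A * Q ^ j) := by
      have : ∀ j, Q ^ n + X ^ A * Q ^ (n + j) = Q ^ n * (1 + X ^ A * Q ^ j) := fun j => by ring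
      simp only [this, Finset.prod_mul_distrib, Finset.prod_const, Finset.card_range, ← pow_mul]
    have e2 : ∏ j ∈ Finset.range n, (Q ^ n + X ^ A * Q ^ j) = 
        X ^ (A * n) * Q ^ (n.choose 2) * ∏ j ∈ Finset.range n, (1 + X ^ B * Q ^ j) := by
      have s : ∏ j ∈ Finset.range n, (Q ^ n + X ^ A * Q ^ j) = 
          ∏ j ∈ Finset.range n, (X ^ A * Q ^ j * (1 + X ^ B * Q ^ (n - 1 - j))) := by
        refine Finset.prod_congr rfl fun j hj => ?_
        have hj' := Finset.mem_range.1 hj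
        have : Q ^ n = X ^ A * X ^ B * Q ^ j * Q ^ (n - 1 - j) := by
          rw [← pow_add, ← hQ, mul_assoc, ← pow_add, ← pow_succ']; congr 1; omega
        rw [this]; ring
      rw [s, Finset.prod_mul_distrib, Finset.prod_mul_distrib, Finset.prod_const, Finset.card_range,
        Finset.prod_range_reflect (fun j => 1 + X ^ B * Q ^ j) n, Finset.prod_pow_eq_pow_sum,
        Finset.sum_range_id, ← Nat.choose_two_right, ← pow_mul]
    rw [e1, e2]
    simp only [hQ, ← pow_mul]
    ring
  rw [l, key]
  refine Finset.sum_congr rfl fun p hp => ?_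
  have hp' := Finset.HasAntidiagonal.mem_antidiagonal.1 hp
  have ee : (A + B) * p.1.choose 2 + A * p.1 + (A + B) * n * p.2 =
      A * n + (A + B) * (n.choose 2 + n * n) + (w ((p.1 : ℤ) - n)).toNat := by
    zify
    rw [Int.toNat_of_nonneg (h0 _)]
    have h1 := hw ((p.1 : ℤ) - n)
    have h2 := c2 p.1
    have h3 := c2 n
    have h4 : (p.2 : ℤ) = 2 * n - p.1 := by have := congrArg (Nat.cast : ℕ → ℤ) hp'; push_cast at this; linarith
    rw [h4]
    have : ∀ a b : ℤ, 2 * a = 2 * b → a = b := fun a b h => by omega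
    apply this
    linear_combination -h1 + ((A : ℤ) + B) * h2 - ((A : ℤ) + B) * h3
  rw [hQ, ← pow_mul, ← pow_mul, ← pow_mul, mul_left_comm, ← pow_add, ← ee, pow_add, pow_add]
  ring

theorem GS_trunc (w : ℤ → ℤ) (h0 : ∀ m, |m| ≤ w m) (M n : ℕ) (hn : M ≤ n) :
    (X : PowerSeries ℤ) ^ M ∣ GS Set.univ w - ∑ p ∈ Finset.HasAntidiagonal.antidiagonal (2 * n),
      X ^ (w ((p.1 : ℤ) - n)).toNat := by
  rw [PowerSeries.X_pow_dvd_iff]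
  intro i hi
  rw [map_sub, map_sum, sub_eq_zero]
  simp only [PowerSeries.coeff_X_pow]
  rw [← Finset.sum_filter, Finset.sum_const, nsmul_eq_mul, mul_one, GS, PowerSeries.coeff_mk]
  congr 1
  rw [← Set.ncard_coe_finset]
  symm
  refine Set.ncard_congr (fun p _ => (p.1 : ℤ) - n) ?_ ?_ ?_
  · rintro ⟨a, b⟩ h
    simp only [Finset.coe_filter, Set.mem_ofPred_eq] at h
    refine ⟨by simp, ?_⟩
    have := (abs_nonneg _).trans (h0 ((a : ℤ) - n))
    simp only
    omega
  · rintro ⟨a, b⟩ ⟨c, d⟩ h h' e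
    simp only [Finset.coe_filter, Set.mem_ofPred_eq, Finset.HasAntidiagonal.mem_antidiagonal] at h h' e
    ext <;> simp <;> omega
  · rintro m ⟨_, hm⟩
    have := h0 m
    have h2 := abs_le.1 this
    refine ⟨((m + n).toNat, (n - m).toNat), ?_, ?_⟩
    · simp only [Finset.coe_filter, Set.mem_ofPred_eq, Finset.HasAntidiagonal.mem_antidiagonal]
      have e : (((m + n).toNat : ℕ) : ℤ) - n = m := by omega
      rw [e]
      omega
    · simp only; omega

section T
variable {T : Type} [CommRing T]

/-- truncated product `∏ (1 + c d^j)` -/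
def PP (n : ℕ) (c d : T) : T := ∏ j ∈ Finset.range n, (1 + c * d ^ j)

theorem gb_map {R S : Type} [CommRing R] [CommRing S] (h : R →+* S) (Q : R) (N : ℕ) :
    ∀ k, h (gb Q N k) = gb (h Q) N k := by
  induction N with
  | zero => 
    intro k
    cases k with
    | zero => simp [gb_zero]
    | succ k => simp [gb_lt]
  | succ N ih =>
    intro k
    cases k with
    | zero => simp [gb_zero]
    | succ k => simp [gb_succ, ih]

theorem qp_stable (Q : T) (M : ℕ) (hM : Q ^ M = 0) (k : ℕ) : qp Q (M + k) = qp Q M := by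
  induction k with
  | zero => rfl
  | succ k ih => 
    rw [← add_assoc, qp_succ, ih, add_assoc, pow_add, hM]; ring

theorem qp_unit (Q : T) (M : ℕ) (hM : Q ^ M = 0) (n : ℕ) : IsUnit (qp Q n) := by
  unfold qp
  refine Finset.prod_induction _ IsUnit (fun _ _ => IsUnit.mul) isUnit_one fun j _ => ?_
  exact IsNilpotent.isUnit_one_sub ⟨M, by rw [← pow_mul, mul_comm, pow_mul, hM, zero_pow (by omega)]⟩

theorem jtp (h : PowerSeries ℤ →+* T) (x : T) (hx : h X = x) (M : ℕ) (hM : x ^ M = 0) (n : ℕ) (hn : 2 * M ≤ n)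
    (A B : ℕ) (hAB : 0 < A + B) (w : ℤ → ℤ) (h0 : ∀ m, |m| ≤ w m)
    (hw : ∀ m, 2 * w m = A * (m * (m + 1)) + B * (m * (m - 1))) :
    h (GS Set.univ w) = qp (x ^ (A + B)) n * (PP n (x ^ A) (x ^ (A + B)) * PP n (x ^ B) (x ^ (A + B))) := by
  have t : h (GS Set.univ w) = ∑ p ∈ Finset.HasAntidiagonal.antidiagonal (2 * n), x ^ (w ((p.1 : ℤ) - n)).toNat := by
    obtain ⟨Y, hY⟩ := GS_trunc w h0 M n (by omega)
    have := congrArg h hY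
    rw [map_mul, map_pow, hx, hM, zero_mul, map_sub, sub_eq_zero, map_sum] at this
    simpa [hx] using this
  have f := congrArg h (finJTP A B n w (fun m => (abs_nonneg m).trans (h0 m)) hw)
  simp only [map_prod, map_mul, map_add, map_one, map_pow, hx, map_sum, gb_map] at f
  rw [PP, PP, ← Finset.prod_mul_distrib, f, t, Finset.mul_sum]
  refine Finset.sum_congr rfl fun p hp => ?_
  have hp' := Finset.HasAntidiagonal.mem_antidiagonal.1 hp
  set Q := x ^ (A + B) with hQ
  have hQM : Q ^ M = 0 := by rw [hQ, ← pow_mul, mul_comm, pow_mul, hM, zero_pow (by omega)]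
  by_cases hc : M ≤ (w ((p.1 : ℤ) - n)).toNat
  · have : x ^ (w ((p.1 : ℤ) - n)).toNat = 0 := by
      rw [show (w ((p.1 : ℤ) - n)).toNat = M + ((w ((p.1 : ℤ) - n)).toNat - M) by omega, pow_add, hM, zero_mul]
    rw [this]; ring
  · have h1 := abs_le.1 (h0 ((p.1 : ℤ) - n))
    have g := gb_qp Q (2 * n) p.1 p.2 hp'
    have s : ∀ k, M ≤ k → qp Q k = qp Q n := by
      intro k hk
      rw [show k = M + (k - M) by omega, show n = M + (n - M) by omega, qp_stable Q M hQM, qp_stable Q M hQM]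
    rw [s p.1 (by omega), s p.2 (by omega), s (2 * n) (by omega)] at g
    have g1 : qp Q n * gb Q (2 * n) p.1 = 1 := by
      refine (qp_unit Q M hQM n).mul_left_cancel ?_
      linear_combination g
    rw [← mul_assoc, g1, one_mul]

end T


theorem psi_GS' : psi 1 = GS Set.univ (fun m : ℤ => 2 * m ^ 2 - m) := by
  rw [psi_GS]
  refine GS_bij (fun k => if k % 2 = 0 then -(k / 2) else (k + 1) / 2)
    (fun m => if 0 < m then 2 * m - 1 else -2 * m) ?_ ?_ ?_ ?_ ?_
  · simp
  · intro m _
    simp only [Set.mem_ofPred_eq]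
    split_ifs <;> omega
  · intro k hk
    simp only [Set.mem_ofPred_eq] at hk
    split_ifs <;> omega
  · intro m _
    split_ifs <;> omega
  · intro k _
    have h := two_tri k
    split_ifs with h'
    · obtain ⟨c, rfl⟩ : ∃ c, k = 2 * c := ⟨k / 2, by omega⟩
      rw [show 2 * c / 2 = c by omega]
      push_cast
      nlinarith
    · obtain ⟨c, rfl⟩ : ∃ c, k = 2 * c - 1 := ⟨(k + 1) / 2, by omega⟩
      rw [show (2 * c - 1 + 1) / 2 = c by omega]
      push_cast
      nlinarith

section T2
variable {T : Type} [CommRing T]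

theorem PP_stable (c d : T) (M : ℕ) (hd : d ^ M = 0) (n N : ℕ) (hn : M ≤ n) (hN : n ≤ N) :
    PP N c d = PP n c d := by
  obtain ⟨k, rfl⟩ := Nat.exists_eq_add_of_le hN
  unfold PP
  rw [Finset.prod_range_add]
  have : ∏ j ∈ Finset.range k, (1 + c * d ^ (n + j)) = 1 := by
    refine Finset.prod_eq_one fun j _ => ?_
    rw [show n + j = M + (n - M + j) by omega, pow_add, hd]; ring
  rw [this, mul_one]

theorem PP_split (c d : T) (k n : ℕ) : PP (k * n) c d = ∏ i ∈ Finset.range k, PP n (c * d ^ i) (d ^ k) := by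
  induction n with
  | zero => simp [PP]
  | succ n ih =>
    have : ∀ i, PP (n + 1) (c * d ^ i) (d ^ k) = PP n (c * d ^ i) (d ^ k) * (1 + c * d ^ i * (d ^ k) ^ n) :=
      fun i => Finset.prod_range_succ _ _
    simp only [this]
    rw [Finset.prod_mul_distrib, ← ih, mul_add, mul_one, PP, Finset.prod_range_add]
    congr 1
    refine Finset.prod_congr rfl fun i _ => ?_
    rw [pow_add, pow_mul]; ring

theorem qp_PP (Q : T) (n : ℕ) : qp Q n = PP n (-Q) Q := by
  unfold qp PP
  refine Finset.prod_congr rfl fun i _ => ?_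
  ring

theorem abs_w2 (m : ℤ) : |m| ≤ 2 * m ^ 2 - m := by
  have h2 := abs_le_sq m
  have h3 := le_abs_self m
  nlinarith

theorem phiT (h : PowerSeries ℤ →+* T) (x : T) (hx : h X = x) (M : ℕ) (hM : x ^ M = 0) (n : ℕ)
    (hn : 2 * M ≤ n) : h (phi 1) = qp (x ^ 2) n * PP n x (x ^ 2) ^ 2 := by
  have := jtp h x hx M hM n hn 1 1 (by norm_num) (fun m => ((1 : ℕ) : ℤ) * m ^ 2)
    (fun m => by have := abs_le_sq m; push_cast; linarith) (fun m => by push_cast; ring)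
  rw [phi_GS, this, pow_one]; ring

theorem psiT (h : PowerSeries ℤ →+* T) (x : T) (hx : h X = x) (M : ℕ) (hM : x ^ M = 0) (n : ℕ)
    (hn : 2 * M ≤ n) : h (psi 1) = qp (x ^ 4) n * PP n x (x ^ 2) := by
  have := jtp h x hx M hM n hn 1 3 (by norm_num) (fun m => 2 * m ^ 2 - m)
    abs_w2 (fun m => by push_cast; ring)
  rw [psi_GS', this, pow_one]
  have e := PP_split x (x ^ 2) 2 n
  rw [PP_stable x (x ^ 2) M (by rw [← pow_mul, mul_comm, pow_mul, hM]; ring) n (2 * n) (by omega) (by omega)] at e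
  rw [e]
  simp only [Finset.prod_range_succ, Finset.prod_range_zero]
  ring

theorem uT (h : PowerSeries ℤ →+* T) (x : T) (hx : h X = x) (M : ℕ) (hM : x ^ M = 0) (n : ℕ)
    (hn : 2 * M ≤ n) : h uu * qp (x ^ 4) n = qp (x ^ 2) n ^ 2 := by
  have h1 : h uu = qp (x ^ 4) n * PP n (-x ^ 2) (x ^ 4) ^ 2 := by
    have := phiT ((h.comp (PowerSeries.expand 2 two_ne_zero : PowerSeries ℤ →ₐ[ℤ] PowerSeries ℤ).toRingHom).comp ng)
      (- x ^ 2) (by simp [ng_X, hx]) M (by rw [show (-x ^ 2) ^ M = (-1) ^ M * (x ^ M) ^ 2 by rw [neg_pow, ← pow_mul, mul_comm 2, pow_mul], hM]; simp) n hn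
    rw [show (-x ^ 2) ^ 2 = x ^ 4 by ring] at this
    rw [← this]; rfl
  have e := PP_split (-x ^ 2) (x ^ 2) 2 n
  rw [PP_stable (-x ^ 2) (x ^ 2) M (by rw [← pow_mul, mul_comm, pow_mul, hM]; ring) n (2 * n) (by omega) (by omega)] at e
  simp only [Finset.prod_range_succ, Finset.prod_range_zero] at e
  rw [show (x ^ 2) ^ 2 = x ^ 4 by ring, show -x ^ 2 * (x ^ 2) ^ 1 = - x ^ 4 by ring, ← qp_PP, ← qp_PP] at e
  rw [h1, e]
  ring

theorem ffT (h : PowerSeries ℤ →+* T) (x : T) (hx : h X = x) (M : ℕ) (hM : x ^ M = 0) (n : ℕ)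
    (hn : 2 * M ≤ n) (k : ℕ) (hk : 0 < k) (hk' : k < 4) :
    h (ff k) = qp (x ^ 14) n * (PP n (x ^ (7 + 2 * k)) (x ^ 14) * PP n (x ^ (7 - 2 * k)) (x ^ 14)) := by
  have e : 7 + 2 * k + (7 - 2 * k) = 14 := by omega
  have key : ∀ n : ℤ, |n| ≤ 7 * n ^ 2 + 2 * k * n := by
    intro n
    have h2 := abs_le_sq n
    have h3 : -(6 * |n|) ≤ 2 * k * n := by
      rcases abs_cases n with ⟨h, h'⟩ | ⟨h, h'⟩ <;> rw [h] <;> nlinarith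
    nlinarith
  have := jtp h x hx M hM n hn (7 + 2 * k) (7 - 2 * k) (by omega) (fun m => 7 * m ^ 2 + 2 * k * m)
    key (fun m => by
      rw [Nat.cast_sub (by omega)]; push_cast; ring)
  rw [e] at this
  rw [ff, this]

theorem prodT (h : PowerSeries ℤ →+* T) (x : T) (hx : h X = x) (M : ℕ) (hM : x ^ M = 0) :
    h ((ff 1 * (ff 2 * ff 3)) ^ 3 * phi 7 ^ 5 * psi 1 * uu) = h ((psi 7 * u7) ^ 7 * phi 1 ^ 2) := by
  set n := 2 * M with hn
  have hM7 : (x ^ 7) ^ M = 0 := by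
    rw [← pow_mul, mul_comm, pow_mul, hM]; ring
  set h7 := h.comp (PowerSeries.expand 7 (by norm_num) : PowerSeries ℤ →ₐ[ℤ] PowerSeries ℤ).toRingHom with hh7
  have hx7 : h7 X = x ^ 7 := by simp [hh7, hx]
  have f1 := ffT h x hx M hM n le_rfl 1 (by norm_num) (by norm_num)
  have f2 := ffT h x hx M hM n le_rfl 2 (by norm_num) (by norm_num)
  have f3 := ffT h x hx M hM n le_rfl 3 (by norm_num) (by norm_num)
  have p1 := phiT h x hx M hM n le_rfl
  have s1 := psiT h x hx M hM n le_rfl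
  have u1 := uT h x hx M hM n le_rfl
  have p7 := phiT h7 (x ^ 7) hx7 M hM7 n le_rfl
  have s7 := psiT h7 (x ^ 7) hx7 M hM7 n le_rfl
  have w7 := uT h7 (x ^ 7) hx7 M hM7 n le_rfl
  have a1 : h7 (phi 1) = h (phi 7) := by
    have := phi_expand 7 (by norm_num) 1
    norm_num at this
    rw [← this]; rfl
  have a2 : h7 (psi 1) = h (psi 7) := by
    have := psi_expand 7 (by norm_num) 1
    norm_num at this
    rw [← this]; rfl
  have a3 : h7 uu = h u7 := rfl
  have c := PP_split x (x ^ 2) 7 n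
  rw [PP_stable x (x ^ 2) M (by rw [← pow_mul, mul_comm, pow_mul, hM]; ring) n (7 * n) (by omega) (by omega)] at c
  simp only [Finset.prod_range_succ, Finset.prod_range_zero] at c
  norm_num at f1 f2 f3
  simp only [← pow_mul, ← pow_succ', ← pow_succ, mul_one, one_mul, pow_zero] at p1 s1 u1 p7 s7 w7 c
  norm_num at p1 s1 u1 p7 s7 w7 c
  rw [a1] at p7
  rw [a2] at s7
  rw [a3] at w7
  simp only [map_mul, map_pow]
  have su : h (psi 1) * h uu = qp (x ^ 2) n ^ 2 * PP n x (x ^ 2) := by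
    rw [s1, ← u1]; ring
  have su7 : h (psi 7) * h u7 = qp (x ^ 14) n ^ 2 * PP n (x ^ 7) (x ^ 14) := by
    rw [s7, ← w7]; ring
  rw [mul_assoc _ (h (psi 1)), su, su7, f1, f2, f3, p1, p7, c]
  ring

end T2

theorem prod_id : (ff 1 * (ff 2 * ff 3)) ^ 3 * phi 7 ^ 5 * psi 1 * uu = (psi 7 * u7) ^ 7 * phi 1 ^ 2 := by
  ext i
  have := prodT (Ideal.Quotient.mk (Ideal.span {(X : PowerSeries ℤ) ^ (i + 1)})) _ rfl (i + 1) (by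
    rw [← map_pow, Ideal.Quotient.eq_zero_iff_mem]; exact Ideal.mem_span_singleton_self _)
  rw [Ideal.Quotient.eq, Ideal.mem_span_singleton, PowerSeries.X_pow_dvd_iff] at this
  have h := this i (by omega)
  rw [map_sub] at h
  linarith


theorem alg (t α β Y Y' M : PowerSeries ℤ) (h1 : α * β = t ^ 8)
    (h2 : (1 - α) * (1 - β) = (1 - t) ^ 8) (h3 : t * (1 - t) * Y ^ 3 = β * (1 - β))
    (h5 : Y * Y' = (t * (1 - t)) ^ 2) (h6 : M ^ 2 * (α - t) = 7 * (t - β))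
    (t0 : t ≠ 0) (Y0 : Y ≠ 0) (a0 : α - t ≠ 0)
    (ct : PowerSeries.constantCoeff t = 0) (cY : PowerSeries.constantCoeff Y = 0)
    (cY' : PowerSeries.constantCoeff Y' = 2) (cM : PowerSeries.constantCoeff M = 1) :
    M * (1 - 2 * t) = 1 - 4 * Y := by
  have c2 : PowerSeries.constantCoeff (2 : PowerSeries ℤ) = 2 := map_ofNat _ 2
  have c3 : PowerSeries.constantCoeff (3 : PowerSeries ℤ) = 3 := map_ofNat _ 3
  have c4 : PowerSeries.constantCoeff (4 : PowerSeries ℤ) = 4 := map_ofNat _ 4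
  have c7 : PowerSeries.constantCoeff (7 : PowerSeries ℤ) = 7 := map_ofNat _ 7
  have t1 : 1 - t ≠ 0 := ps_ne _ (by simp [ct])
  have w0 : t * (1 - t) ≠ 0 := mul_ne_zero t0 t1
  have h4 : t * (1 - t) * Y' ^ 3 = α * (1 - α) := by
    have n : t * (1 - t) * Y ^ 3 ≠ 0 := mul_ne_zero w0 (pow_ne_zero 3 Y0)
    apply mul_left_cancel₀ n
    have e1 : (t * (1 - t) * Y ^ 3) * (t * (1 - t) * Y' ^ 3) = t ^ 8 * (1 - t) ^ 8 := by
      rw [show (t * (1 - t) * Y ^ 3) * (t * (1 - t) * Y' ^ 3) = (t * (1 - t)) ^ 2 * (Y * Y') ^ 3 by ring, h5]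
      ring
    rw [e1, h3, ← h1, ← h2]; ring
  have hE : α + β = 1 + t ^ 8 - (1 - t) ^ 8 := by linear_combination h1 - h2
  obtain ⟨w, hw⟩ : ∃ w, w = t * (1 - t) := ⟨_, rfl⟩
  obtain ⟨σ, hσ⟩ : ∃ σ, σ = 2 - 7 * w + 4 * w ^ 2 := ⟨_, rfl⟩
  have cw : PowerSeries.constantCoeff w = 0 := by rw [hw, map_mul, ct, zero_mul]
  have cσ : PowerSeries.constantCoeff σ = 2 := by
    rw [hσ]; simp only [map_add, map_sub, map_mul, map_pow, cw, c2, c4, c7]; norm_num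
  have h5' : Y * Y' = w ^ 2 := by rw [h5, hw]
  have hs : Y + Y' = σ := by
    have k1 : w * ((Y + Y') ^ 3 - 3 * w ^ 2 * (Y + Y')) = w * (σ ^ 3 - 3 * w ^ 2 * σ) := by
      have l1 : w * ((Y + Y') ^ 3 - 3 * w ^ 2 * (Y + Y')) = (α + β) - (α + β) ^ 2 + 2 * t ^ 8 := by
        rw [← h5', ← h1]
        rw [← hw] at h3 h4
        linear_combination h3 + h4
      rw [l1, hE, hσ, hw]; ring
    have k2 := mul_left_cancel₀ (by rwa [hw]) k1
    have k3 : ((Y + Y') ^ 2 + (Y + Y') * σ + σ ^ 2 - 3 * w ^ 2) * (Y + Y' - σ) = 0 := by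
      linear_combination k2
    rcases mul_eq_zero.1 k3 with k | k
    · exfalso
      revert k
      apply ps_ne
      simp only [map_add, map_sub, map_mul, map_pow, cw, cσ, cY, cY', c3]; norm_num
    · exact sub_eq_zero.1 k
  have hd : (β - α) * (1 - 2 * t) = 4 * w * (1 - w) * (Y - Y') := by
    have n : (1 - 2 * w) * (1 - 4 * w + 2 * w ^ 2) ≠ 0 := by
      apply ps_ne
      simp only [map_add, map_sub, map_mul, map_pow, cw, c2, c4, map_one]; norm_num
    apply mul_left_cancel₀ n
    have l1 : w * (Y - Y') * (σ ^ 2 - w ^ 2) = (β - α) * (1 - (α + β)) := by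
      rw [← h5', ← hs]
      rw [← hw] at h3 h4
      linear_combination h3 - h4
    have l2 : σ ^ 2 - w ^ 2 = 4 * (1 - w) * ((1 - 2 * w) * (1 - 4 * w + 2 * w ^ 2)) := by
      rw [hσ]; ring
    have l3 : 1 - (α + β) = (1 - 2 * t) * ((1 - 2 * w) * (1 - 4 * w + 2 * w ^ 2)) := by
      rw [hE, hw]; ring
    rw [l2, l3] at l1
    linear_combination -l1
  have hY : Y ^ 2 - σ * Y + w ^ 2 = 0 := by rw [← h5', ← hs]; ring
  have nb : 2 * ((1 - 2 * t) * β) = (1 - 2 * t) * (1 + t ^ 8 - (1 - t) ^ 8) + 4 * w * (1 - w) * (2 * Y - σ) := by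
    rw [← hs]; linear_combination hd + (1 - 2 * t) * hE
  have na : 2 * ((1 - 2 * t) * α) = (1 - 2 * t) * (1 + t ^ 8 - (1 - t) ^ 8) - 4 * w * (1 - w) * (2 * Y - σ) := by
    rw [← hs]; linear_combination -hd + (1 - 2 * t) * hE
  have fin0 : (1 - 2 * t) ^ 2 * (7 * (t - β)) = (1 - 4 * Y) ^ 2 * (α - t) := by
    have n : 2 * (1 - 2 * t) ≠ 0 := by
      apply ps_ne
      simp only [map_sub, map_mul, ct, c2, map_one]; norm_num
    apply mul_left_cancel₀ n
    have l : (1 - 2 * t) ^ 2 * (7 * (2 * (1 - 2 * t) * t - ((1 - 2 * t) * (1 + t ^ 8 - (1 - t) ^ 8) + 4 * w * (1 - w) * (2 * Y - σ))))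
        = (1 - 4 * Y) ^ 2 * (((1 - 2 * t) * (1 + t ^ 8 - (1 - t) ^ 8) - 4 * w * (1 - w) * (2 * Y - σ)) - 2 * (1 - 2 * t) * t) := by
      rw [hσ, hw] at *
      linear_combination (128 * (t * (1 - t)) * (1 - t * (1 - t)) * Y + (-16 * ((1 - 2 * t) * (1 + t ^ 8 - (1 - t) ^ 8) + 4 * (t * (1 - t)) * (1 - t * (1 - t)) * (2 - 7 * (t * (1 - t)) + 4 * (t * (1 - t)) ^ 2) - 2 * (1 - 2 * t) * t) - 64 * (t * (1 - t)) * (1 - t * (1 - t)) + 128 * (t * (1 - t)) * (1 - t * (1 - t)) * (2 - 7 * (t * (1 - t)) + 4 * (t * (1 - t)) ^ 2))) * hY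
    rw [← nb, ← na] at l
    linear_combination l
  apply eq_of_sq
  · apply mul_right_cancel₀ a0
    rw [← fin0, ← h6]; ring
  · simp only [map_add, map_sub, map_mul, cM, ct, cY, c2, c4, map_one]; norm_num

theorem cc_exp (p : ℕ) (hp : p ≠ 0) (f : PowerSeries ℤ) :
    PowerSeries.constantCoeff (PowerSeries.expand p hp f) = PowerSeries.constantCoeff f := by
  simp

theorem inv_ex (f : PowerSeries ℤ) (h : PowerSeries.constantCoeff f = 1) :
    ∃ g : PowerSeries ℤ, f * g = 1 ∧ PowerSeries.constantCoeff g = 1 := by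
  have : IsUnit f := PowerSeries.isUnit_iff_constantCoeff.2 (by rw [h]; exact isUnit_one)
  obtain ⟨g, hg⟩ := this.exists_right_inv
  refine ⟨g, hg, ?_⟩
  have := congrArg PowerSeries.constantCoeff hg
  rwa [map_mul, h, one_mul, map_one] at this

theorem star0 (p p7 s s7 e e7 m m7 u u7 F : PowerSeries ℤ)
    (hprod : F ^ 3 * p7 ^ 5 * s * u = (s7 * u7) ^ 7 * p ^ 2)
    (hse : s ^ 2 = p * e) (hse7 : s7 ^ 2 = p7 * e7) (hpm : p * m = u ^ 2) (hpm7 : p7 * m7 = u7 ^ 2)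
    (hq : p ^ 4 = m ^ 4 + 16 * X * e ^ 4) (hq7 : p7 ^ 4 = m7 ^ 4 + 16 * X ^ 7 * e7 ^ 4)
    (hd : p * p7 = u * u7 + 2 * X * s * s7)
    (hr : (2 * X * s * s7) * (m ^ 4 + 7 * m7 ^ 4) = 16 * (u * u7) * (X * e ^ 4 + 7 * X ^ 7 * e7 ^ 4))
    (cp : PowerSeries.constantCoeff p = 1) (cp7 : PowerSeries.constantCoeff p7 = 1)
    (cs : PowerSeries.constantCoeff s = 1) (cs7 : PowerSeries.constantCoeff s7 = 1)
    (cu : PowerSeries.constantCoeff u = 1) (cu7 : PowerSeries.constantCoeff u7 = 1) :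
    8 * X ^ 2 * F = p7 * (p7 * p7) - p7 * (p * p) + 4 * X * s * s7 * p := by
  have c2 : PowerSeries.constantCoeff (2 : PowerSeries ℤ) = 2 := map_ofNat _ 2
  have c16 : PowerSeries.constantCoeff (16 : PowerSeries ℤ) = 16 := map_ofNat _ 16
  have cF : PowerSeries.constantCoeff F = 1 := by
    have := congrArg PowerSeries.constantCoeff hprod
    simp only [map_mul, map_pow, cp, cp7, cs, cs7, cu, cu7, one_pow, mul_one] at this
    have o : Odd 3 := by decide
    exact o.strictMono_pow.injective (by simpa using this)
  obtain ⟨P, hP, cP⟩ := inv_ex p cp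
  obtain ⟨Q, hQ, cQ⟩ := inv_ex p7 cp7
  obtain ⟨G, hG, cG⟩ := inv_ex F cF
  have he : e = s ^ 2 * P := by rw [hse]; linear_combination -e * hP
  have he7 : e7 = s7 ^ 2 * Q := by rw [hse7]; linear_combination -e7 * hQ
  have hm : m = u ^ 2 * P := by rw [← hpm]; linear_combination -m * hP
  have hm7 : m7 = u7 ^ 2 * Q := by rw [← hpm7]; linear_combination -m7 * hQ
  have PQ : p * p7 * (P * Q) = 1 := by linear_combination p7 * Q * hP + hQ
  have P4 : p ^ 4 * P ^ 4 = 1 := by rw [← mul_pow, hP, one_pow]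
  have Q4 : p7 ^ 4 * Q ^ 4 = 1 := by rw [← mul_pow, hQ, one_pow]
  have Q3 : p7 ^ 3 * Q ^ 3 = 1 := by rw [← mul_pow, hQ, one_pow]
  have Q5 : p7 ^ 5 * Q ^ 5 = 1 := by rw [← mul_pow, hQ, one_pow]
  have P2 : p ^ 2 * P ^ 2 = 1 := by rw [← mul_pow, hP, one_pow]
  have Q2 : p7 ^ 2 * Q ^ 2 = 1 := by rw [← mul_pow, hQ, one_pow]
  have ht1 : 1 - 2 * X * s * s7 * (P * Q) = u * u7 * (P * Q) := by
    linear_combination -PQ + (P * Q) * hd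
  have ha1 : 1 - 16 * X * s ^ 8 * P ^ 8 = u ^ 8 * P ^ 8 := by
    rw [he, hm] at hq
    linear_combination -P4 + P ^ 4 * hq
  have hb1 : 1 - 16 * X ^ 7 * s7 ^ 8 * Q ^ 8 = u7 ^ 8 * Q ^ 8 := by
    rw [he7, hm7] at hq7
    linear_combination -Q4 + Q ^ 4 * hq7
  have hF : F ^ 3 * s * u * P ^ 2 = (s7 * u7) ^ 7 * Q ^ 5 := by
    linear_combination P ^ 2 * Q ^ 5 * hprod - F ^ 3 * s * u * P ^ 2 * Q5 + (s7 * u7) ^ 7 * Q ^ 5 * P2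
  have main := alg (2 * X * s * s7 * (P * Q)) (16 * X * s ^ 8 * P ^ 8) (16 * X ^ 7 * s7 ^ 8 * Q ^ 8)
    (2 * X ^ 2 * F * Q ^ 3) (2 * (s * s7 * u * u7) ^ 2 * p7 ^ 3 * (P * Q) ^ 4 * G) (p ^ 2 * Q ^ 2)
    (by ring) (by rw [ha1, hb1, ht1]; ring)
    (by
      rw [hb1, ht1]
      linear_combination 16 * X ^ 7 * s7 * u7 * Q ^ 11 * hF)
    (by
      rw [ht1]
      linear_combination 4 * X ^ 2 * (s * s7 * u * u7) ^ 2 * (P * Q) ^ 4 * (p7 ^ 3 * Q ^ 3 * hG + Q3))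
    (by
      have r2 : (2 * X * s * s7) * (p ^ 4 + 7 * p7 ^ 4) = p * p7 * (16 * X * e ^ 4 + 7 * (16 * X ^ 7 * e7 ^ 4)) := by
        rw [hq, hq7, hd]; linear_combination hr
      have r3 : (2 * X * s * s7 * (P * Q)) * (p ^ 4 + 7 * p7 ^ 4) = 16 * X * e ^ 4 + 7 * (16 * X ^ 7 * e7 ^ 4) := by
        linear_combination (P * Q) * r2 + (16 * X * e ^ 4 + 7 * (16 * X ^ 7 * e7 ^ 4)) * PQ
      rw [he, he7] at r3
      linear_combination -Q ^ 4 * r3 + 16 * X * s ^ 8 * P ^ 4 * Q ^ 4 * P4 + 7 * (2 * X * s * s7 * (P * Q)) * Q4)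
    (by
      have : s * s7 * (P * Q) ≠ 0 := ps_ne _ (by simp only [map_mul, cs, cs7, cP, cQ]; norm_num)
      have h := mul_ne_zero (mul_ne_zero two_ne PowerSeries.X_ne_zero) this
      intro h'; apply h; rw [← h']; ring)
    (by
      have : F * Q ^ 3 ≠ 0 := ps_ne _ (by simp only [map_mul, map_pow, cF, cQ]; norm_num)
      have h := mul_ne_zero (mul_ne_zero two_ne (pow_ne_zero 2 PowerSeries.X_ne_zero)) this
      intro h'; apply h; rw [← h']; ring)
    (by
      have : 16 * (s ^ 8 * P ^ 8) - 2 * (s * s7 * (P * Q)) ≠ 0 :=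
        ps_ne _ (by simp only [map_sub, map_mul, map_pow, cs, cs7, cP, cQ, c2, c16]; norm_num)
      have h := mul_ne_zero PowerSeries.X_ne_zero this
      intro h'; apply h; rw [← h']; ring)
    (by simp) (by simp)
    (by simp only [map_mul, map_pow, cs, cs7, cP, cQ, cu, cu7, cp7, cG, c2]; norm_num)
    (by simp only [map_mul, map_pow, cp, cQ]; norm_num)
  linear_combination p7 ^ 3 * main - 8 * X ^ 2 * F * Q3 - p7 * p ^ 2 * Q2
     + 4 * X * s * s7 * p * (Q3 + p7 ^ 3 * Q ^ 3 * hP)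

theorem star : 8 * X ^ 2 * (ff 1 * (ff 2 * ff 3)) =
    phi 7 * (phi 7 * phi 7) - phi 7 * (phi 1 * phi 1) + 4 * X * psi 1 * psi 7 * phi 1 := by
  have h7p : PowerSeries.expand 7 (by norm_num) (phi 1) = phi 7 := phi_expand 7 (by norm_num) 1
  have h7s : PowerSeries.expand 7 (by norm_num) (psi 1) = psi 7 := psi_expand 7 (by norm_num) 1
  have h7e : PowerSeries.expand 7 (by norm_num) (psi 2) = psi 14 := psi_expand 7 (by norm_num) 2
  have cm : PowerSeries.constantCoeff mm = 1 := by rw [mm, cc_ng, cc_phi 1 one_pos]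
  have cu : PowerSeries.constantCoeff uu = 1 := by rw [uu, cc_exp, cm]
  have cu7 : PowerSeries.constantCoeff u7 = 1 := by rw [u7, cc_exp, cu]
  have n16 := exp_num 7 (by norm_num) 16
  refine star0 (phi 1) (phi 7) (psi 1) (psi 7) (psi 2) (psi 14) mm m7 uu u7 _ prod_id b3 ?_ pm_eq ?_ quart ?_
    deg7' relII (cc_phi 1 one_pos) (cc_phi 7 (by norm_num)) (cc_psi 1 one_pos) (cc_psi 7 (by norm_num)) cu cu7
  · have := congrArg (PowerSeries.expand 7 (by norm_num)) b3
    rwa [map_pow, map_mul, h7p, h7s, h7e] at this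
  · have := congrArg (PowerSeries.expand 7 (by norm_num)) pm_eq
    rwa [map_pow, map_mul, h7p] at this
  · have := congrArg (PowerSeries.expand 7 (by norm_num)) quart
    rwa [map_add, map_mul, map_mul, map_pow, map_pow, map_pow, PowerSeries.expand_X, h7p, h7e, n16] at this

end T7

/-- Theorem 1.1, second identity. Here `f(q,q⁵)` is `fB 1` and `f(q⁷,q¹⁴)` is `fA 7`. -/
theorem thm_1_1_second :
    7 * phi 7 ^ 2 * psi 7 =
      8 * X ^ 2 * psi 2 * psi 21 * phi 3 + 8 * psi 2 * fB 1 * fA 7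
        - 4 * X * psi 14 * psi 1 * phi 1 - psi 7 * phi 1 ^ 2 :=
  T7.final T7.star
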